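/- arXiv:1709.08917 — 2 statements merged into one kernel-verified Lean document; each statement's English description precedes it below -/
import Mathlib

section
/- Let d ≥ 2, R ≥ 1, n ≥ 1, and let f = (f_1,…,f_R) be polynomials of degree d in n variables with real coefficients, and let F = (F_1,…,F_R) be the system of their degree-d homogeneous parts. Then there exists a constant C > 0 depending only on f such that for every β ∈ ℝ^R and every real B ≥ 2, N^aux_{β·f}(B) ≤ C · B^{(d−2)n + σ*(F)} · (log B)^{d−1}. -/
open MvPolynomial

noncomputable section

/-- Iterated partial derivative along a list of variable indices. -/
def iterPderiv {n : ℕ} {K : Type*} [CommSemiring K] (js : List (Fin n))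
    (f : MvPolynomial (Fin n) K) : MvPolynomial (Fin n) K :=
  js.foldr (fun j g => pderiv j g) f

/-- The system of multilinear forms `m^{(f)}`. -/
def mForm {K : Type*} [CommSemiring K] (d n : ℕ) (f : MvPolynomial (Fin n) K)
    (x : Fin (d - 1) → Fin n → K) : Fin n → K :=
  fun i => ∑ j : Fin (d - 1) → Fin n,
    (∏ k, x k (j k)) * eval (0 : Fin n → K) (pderiv i (iterPderiv (List.ofFn j) f))

/-- The `n × (d-1)n` Jacobian matrix `J^f` of `m^{(f)}`. -/
def jacMat {K : Type*} [CommSemiring K] (d n : ℕ) (f : MvPolynomial (Fin n) K)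
    (x : Fin (d - 1) → Fin n → K) : Matrix (Fin n) (Fin (d - 1) × Fin n) K :=
  fun i kl => mForm d n f (Function.update x kl.1 (Pi.single kl.2 1)) i

/-- σ*(H) for a system of complex forms. -/
def sigmaStar (d n R : ℕ) (H : Fin R → MvPolynomial (Fin n) ℂ) : ℕ :=
  sSup {s : ℕ | ∃ β : Fin R → ℂ, β ≠ 0 ∧ ∃ x : Fin (d - 1) → Fin n → ℂ,
    (∀ k, x k ≠ 0) ∧ mForm d n (∑ ρ, β ρ • H ρ) x = 0 ∧
    s = n - (jacMat d n (∑ ρ, β ρ • H ρ) x).rank}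

/-- σ* for a system with real coefficients. -/
def sigmaStarR (d n R : ℕ) (F : Fin R → MvPolynomial (Fin n) ℝ) : ℕ :=
  sigmaStar d n R fun ρ => (F ρ).map (algebraMap ℝ ℂ)

/-- σ* for a system with integer coefficients. -/
def sigmaStarZ (d n R : ℕ) (F : Fin R → MvPolynomial (Fin n) ℤ) : ℕ :=
  sigmaStar d n R fun ρ => (F ρ).map (Int.castRingHom ℂ)

/-- `‖f^{[d]}‖`. -/
def normFd (d n : ℕ) (f : MvPolynomial (Fin n) ℝ) : ℝ :=
  (d.factorial : ℝ)⁻¹ * ⨆ j : Fin d → Fin n, |eval (0 : Fin n → ℝ) (iterPderiv (List.ofFn j) f)|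

/-- `N^aux_f(B)`. -/
def Naux (d n : ℕ) (g : MvPolynomial (Fin n) ℝ) (B : ℝ) : ℕ :=
  Set.ncard {x : Fin (d - 1) → Fin n → ℤ |
    (∀ k, ‖(fun i => (x k i : ℝ))‖ ≤ B) ∧
    ‖mForm d n g (fun k i => (x k i : ℝ))‖ < normFd d n g * B ^ (d - 2)}

end

section Algebra

variable {n : ℕ}

theorem iterPderiv_sum_smul {K τ : Type*} [CommSemiring K] [Fintype τ] (js : List (Fin n))
    (β : τ → K) (f : τ → MvPolynomial (Fin n) K) :
    iterPderiv js (∑ ρ, β ρ • f ρ) = ∑ ρ, β ρ • iterPderiv js (f ρ) := by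
  induction js with
  | nil => rfl
  | cons j js ih =>
    change pderiv j (iterPderiv js _) = ∑ ρ, β ρ • pderiv j (iterPderiv js (f ρ))
    rw [ih, map_sum]
    exact Finset.sum_congr rfl fun ρ _ => Derivation.map_smul _ _ _

theorem iterPderiv_map {K L : Type*} [CommSemiring K] [CommSemiring L] (φ : K →+* L)
    (js : List (Fin n)) (f : MvPolynomial (Fin n) K) :
    iterPderiv js (f.map φ) = (iterPderiv js f).map φ := by
  induction js with
  | nil => rfl
  | cons j js ih =>
    change pderiv j (iterPderiv js _) = (pderiv j (iterPderiv js f)).map φ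
    rw [ih, pderiv_map]

theorem homogeneousComponent_pderiv {K : Type*} [CommSemiring K] (m : ℕ) (i : Fin n)
    (f : MvPolynomial (Fin n) K) :
    homogeneousComponent m (pderiv i f) = pderiv i (homogeneousComponent (m + 1) f) := by
  ext s
  simp only [coeff_homogeneousComponent, coeff_pderiv, map_add, Finsupp.degree_single,
    add_left_inj, ite_mul, zero_mul]

theorem homogeneousComponent_iterPderiv {K : Type*} [CommSemiring K] (m : ℕ)
    (js : List (Fin n)) (f : MvPolynomial (Fin n) K) :
    homogeneousComponent m (iterPderiv js f) =
      iterPderiv js (homogeneousComponent (m + js.length) f) := by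
  induction js generalizing m with
  | nil => rfl
  | cons j js ih =>
    change homogeneousComponent m (pderiv j (iterPderiv js f)) = pderiv j (iterPderiv js _)
    rw [homogeneousComponent_pderiv, ih, List.length_cons, add_right_comm, add_assoc]

theorem eval_zero_homogeneousComponent {K : Type*} [CommSemiring K]
    (f : MvPolynomial (Fin n) K) :
    eval (0 : Fin n → K) (homogeneousComponent 0 f) = eval (0 : Fin n → K) f := by
  rw [eval_zero, constantCoeff_eq, coeff_homogeneousComponent]
  simp

theorem mForm_homogeneousComponent {K : Type*} [CommSemiring K] {d : ℕ} (hd : 1 ≤ d)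
    (f : MvPolynomial (Fin n) K) (x : Fin (d - 1) → Fin n → K) :
    mForm d n (homogeneousComponent d f) x = mForm d n f x := by
  ext i
  refine Finset.sum_congr rfl fun j _ => ?_
  rw [← eval_zero_homogeneousComponent (pderiv i (iterPderiv (List.ofFn j) f)),
    homogeneousComponent_pderiv, homogeneousComponent_iterPderiv, List.length_ofFn,
    show 0 + 1 + (d - 1) = d by omega]

theorem mForm_map {K L : Type*} [CommSemiring K] [CommSemiring L] (φ : K →+* L) (d : ℕ)
    (f : MvPolynomial (Fin n) K) (x : Fin (d - 1) → Fin n → K) (i : Fin n) :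
    mForm d n (f.map φ) (fun k j => φ (x k j)) i = φ (mForm d n f x i) := by
  simp only [mForm, iterPderiv_map, pderiv_map, map_sum, map_mul, map_prod, eval_zero,
    constantCoeff_map]

theorem mForm_sum_smul {K τ : Type*} [CommSemiring K] [Fintype τ] (d : ℕ)
    (β : τ → K) (f : τ → MvPolynomial (Fin n) K) (x : Fin (d - 1) → Fin n → K) :
    mForm d n (∑ ρ, β ρ • f ρ) x = ∑ ρ, β ρ • mForm d n (f ρ) x := by
  ext i
  simp only [mForm, iterPderiv_sum_smul, map_sum, Finset.sum_apply, Pi.smul_apply, smul_eq_mul,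
    Finset.mul_sum, Derivation.map_smul, smul_eval]
  rw [Finset.sum_comm]
  exact Finset.sum_congr rfl fun ρ _ => Finset.sum_congr rfl fun j _ => mul_left_comm _ _ _

/-- The system `m^{(f)}` as a continuous multilinear map. -/
noncomputable def mFormMultilinear (d n : ℕ) (f : MvPolynomial (Fin n) ℝ) :
    ContinuousMultilinearMap ℝ (fun _ : Fin (d - 1) => Fin n → ℝ) (Fin n → ℝ) :=
  ∑ j : Fin (d - 1) → Fin n,
    ((ContinuousMultilinearMap.mkPiAlgebra ℝ (Fin (d - 1)) ℝ).compContinuousLinearMap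
      fun k => ContinuousLinearMap.proj (j k)).smulRight
        fun i => eval (0 : Fin n → ℝ) (pderiv i (iterPderiv (List.ofFn j) f))

theorem mFormMultilinear_apply (d : ℕ) (f : MvPolynomial (Fin n) ℝ)
    (x : Fin (d - 1) → Fin n → ℝ) : mFormMultilinear d n f x = mForm d n f x := by
  ext i
  simp [mFormMultilinear, mForm]

theorem linearDeriv_mFormMultilinear (d : ℕ) (f : MvPolynomial (Fin n) ℝ)
    (x u : Fin (d - 1) → Fin n → ℝ) (i : Fin n) :
    (mFormMultilinear d n f).linearDeriv x u i =
      ∑ a : Fin (d - 1) × Fin n, u a.1 a.2 * jacMat d n f x i a := by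
  rw [ContinuousMultilinearMap.linearDeriv_apply, Finset.sum_apply, Fintype.sum_prod_type]
  refine Finset.sum_congr rfl fun k _ => ?_
  have h : u k = ∑ l, u k l • (Pi.single l 1 : Fin n → ℝ) := pi_eq_sum_univ' (u k)
  conv_lhs => rw [h]
  change (mFormMultilinear d n f).toMultilinearMap _ i = _
  rw [MultilinearMap.map_update_sum, Finset.sum_apply]
  refine Finset.sum_congr rfl fun l _ => ?_
  rw [MultilinearMap.map_update_smul]
  change _ * mFormMultilinear d n f _ i = _
  rw [mFormMultilinear_apply]
  rfl

theorem jacMat_map {K L : Type*} [CommSemiring K] [CommSemiring L] (φ : K →+* L) (d : ℕ)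
    (f : MvPolynomial (Fin n) K) (x : Fin (d - 1) → Fin n → K) (i : Fin n)
    (a : Fin (d - 1) × Fin n) :
    jacMat d n (f.map φ) (fun k j => φ (x k j)) i a = φ (jacMat d n f x i a) := by
  simp only [jacMat]
  rw [← mForm_map]
  congr 1
  ext k j
  by_cases hk : k = a.1
  · subst hk
    by_cases hj : j = a.2 <;> simp [hj]
  · simp [Function.update_of_ne hk]

theorem Matrix.exists_finset_linearIndependent_col {K ι κ : Type*} [Field K] [Fintype κ]
    (A : Matrix ι κ K) : ∃ S : Finset κ, S.card = A.rank ∧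
      ∀ c : κ → K, (∀ a ∉ S, c a = 0) → (∀ i, ∑ a, c a * A i a = 0) → c = 0 := by
  classical
  obtain ⟨κ', g, hg, hspan, hli⟩ := exists_linearIndependent' K A.col
  have : Fintype κ' := @Fintype.ofFinite κ' (Finite.of_injective g hg)
  refine ⟨Finset.univ.image g, ?_, fun c hc hsum => ?_⟩
  · rw [Finset.card_image_of_injective _ hg, Finset.card_univ, ← finrank_span_eq_card hli, hspan,
      Matrix.rank_eq_finrank_span_cols]
  · rw [Fintype.linearIndependent_iff] at hli
    have h0 := hli (fun t => c (g t)) <| by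
      ext i
      have h1 : ∑ a ∈ Finset.univ.image g, c a * A i a = 0 := by
        rw [← hsum i]
        exact Finset.sum_subset (Finset.subset_univ _) fun a _ ha => by rw [hc a ha, zero_mul]
      rw [Finset.sum_image fun _ _ _ _ h => hg h] at h1
      simpa [Finset.sum_apply] using h1
    ext a
    by_cases ha : a ∈ Finset.univ.image g
    · obtain ⟨t, -, rfl⟩ := Finset.mem_image.1 ha
      exact h0 t
    · exact hc a ha

theorem le_sigmaStar {d R : ℕ} (H : Fin R → MvPolynomial (Fin n) ℂ) {β : Fin R → ℂ} (hβ : β ≠ 0)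
    {x : Fin (d - 1) → Fin n → ℂ} (hx : ∀ k, x k ≠ 0)
    (h0 : mForm d n (∑ ρ, β ρ • H ρ) x = 0) :
    n - (jacMat d n (∑ ρ, β ρ • H ρ) x).rank ≤ sigmaStar d n R H := by
  refine le_csSup ⟨n, ?_⟩ ⟨β, hβ, x, hx, h0, rfl⟩
  rintro s ⟨-, -, -, -, -, rfl⟩
  exact Nat.sub_le _ _

theorem jacMat_homogeneousComponent {K : Type*} [CommSemiring K] {d : ℕ} (hd : 1 ≤ d)
    (f : MvPolynomial (Fin n) K) (x : Fin (d - 1) → Fin n → K) :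
    jacMat d n (homogeneousComponent d f) x = jacMat d n f x := by
  ext i a
  simp only [jacMat, mForm_homogeneousComponent hd]

/-- At a real zero of a nontrivial form in the pencil, at least `n - σ*` columns of the Jacobian
matrix are linearly independent. -/
theorem exists_finset_linearDeriv_injective {d R : ℕ} (hd : 1 ≤ d)
    (f : Fin R → MvPolynomial (Fin n) ℝ) {β : Fin R → ℝ} (hβ : β ≠ 0)
    {x : Fin (d - 1) → Fin n → ℝ} (hx : ∀ k, x k ≠ 0)
    (h0 : ∑ ρ, β ρ • mFormMultilinear d n (f ρ) x = 0) :
    ∃ S : Finset (Fin (d - 1) × Fin n), S.card ≤ n ∧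
      n ≤ S.card + sigmaStarR d n R (fun ρ => homogeneousComponent d (f ρ)) ∧
      ∀ u : Fin (d - 1) → Fin n → ℝ, (∀ k i, (k, i) ∉ S → u k i = 0) →
        ∑ ρ, β ρ • (mFormMultilinear d n (f ρ)).linearDeriv x u = 0 → u = 0 := by
  set φ := algebraMap ℝ ℂ
  set g := ∑ ρ, β ρ • f ρ with hg
  have hH : ∑ ρ, φ (β ρ) • (homogeneousComponent d (f ρ)).map φ
      = (homogeneousComponent d g).map φ := by
    simp [hg, map_sum, smul_eq_C_mul, φ]
  have hm : mForm d n g x = 0 := by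
    rw [hg, mForm_sum_smul]
    simpa only [mFormMultilinear_apply] using h0
  have hle := le_sigmaStar (d := d) (fun ρ => (homogeneousComponent d (f ρ)).map φ)
    (β := fun ρ => φ (β ρ)) (x := fun k j => φ (x k j))
    (fun h => hβ <| by ext ρ; simpa [φ] using congrFun h ρ)
    (fun k h => hx k <| by ext j; simpa [φ] using congrFun h j)
    (by
      rw [hH]
      ext i
      rw [mForm_map, mForm_homogeneousComponent hd, hm]
      simp)
  rw [hH] at hle
  obtain ⟨S, hS, hker⟩ := Matrix.exists_finset_linearIndependent_col
    (jacMat d n ((homogeneousComponent d g).map φ) (fun k j => φ (x k j)))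
  refine ⟨S, ?_, ?_, fun u hu hsum => ?_⟩
  · rw [hS]
    simpa using Matrix.rank_le_card_height
      (jacMat d n ((homogeneousComponent d g).map φ) (fun k j => φ (x k j)))
  · rw [hS, sigmaStarR]
    exact tsub_le_iff_left.1 hle
  · have h1 := hker (fun a => φ (u a.1 a.2)) (fun a ha => by rw [hu a.1 a.2 ha, map_zero])
      fun i => by
        have h2 : ∑ a, u a.1 a.2 * jacMat d n g x i a = 0 := by
          have h3 := congrFun hsum i
          simp only [Finset.sum_apply, Pi.smul_apply, linearDeriv_mFormMultilinear,
            smul_eq_mul, Finset.mul_sum, Pi.zero_apply] at h3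
          rw [Finset.sum_comm] at h3
          rw [← h3]
          refine Finset.sum_congr rfl fun a _ => ?_
          simp only [jacMat, hg, mForm_sum_smul, Finset.sum_apply, Pi.smul_apply, smul_eq_mul,
            Finset.mul_sum]
          exact Finset.sum_congr rfl fun ρ _ => mul_left_comm _ _ _
        simp only [jacMat_map, jacMat_homogeneousComponent hd, ← map_mul, ← map_sum, h2, map_zero]
    ext k i
    simpa [φ] using congrFun h1 (k, i)

theorem normFd_sum_smul_le {d R : ℕ} (f : Fin R → MvPolynomial (Fin n) ℝ) :
    ∃ c : ℝ, 0 < c ∧ ∀ β : Fin R → ℝ, normFd d n (∑ ρ, β ρ • f ρ) ≤ c * ‖β‖ := by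
  set D : Fin R → (Fin d → Fin n) → ℝ :=
    fun ρ j => eval (0 : Fin n → ℝ) (iterPderiv (List.ofFn j) (f ρ)) with hD
  have hA : 0 ≤ ∑ ρ, ∑ j, |D ρ j| := by positivity
  refine ⟨(d.factorial : ℝ)⁻¹ * (∑ ρ, ∑ j, |D ρ j| + 1), by positivity, fun β => ?_⟩
  rw [normFd, mul_assoc]
  refine mul_le_mul_of_nonneg_left (Real.iSup_le (fun j => ?_) (by positivity)) (by positivity)
  calc |eval (0 : Fin n → ℝ) (iterPderiv (List.ofFn j) (∑ ρ, β ρ • f ρ))|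
      = |∑ ρ, β ρ * D ρ j| := by simp [iterPderiv_sum_smul, hD]
    _ ≤ ∑ ρ, |β ρ * D ρ j| := Finset.abs_sum_le_sum_abs _ _
    _ ≤ ∑ ρ, ‖β‖ * ∑ j, |D ρ j| := Finset.sum_le_sum fun ρ _ => by
        rw [abs_mul]
        exact mul_le_mul (norm_le_pi_norm β ρ)
          (Finset.single_le_sum (f := fun j => |D ρ j|) (fun _ _ => abs_nonneg _)
            (Finset.mem_univ j)) (abs_nonneg _) (norm_nonneg _)
    _ ≤ (∑ ρ, ∑ j, |D ρ j| + 1) * ‖β‖ := by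
        rw [← Finset.mul_sum, mul_comm]
        gcongr
        linarith

end Algebra

section Counting

open Topology

theorem finite_and_ncard_le_prod_of_fiber {σ : Type*} [Fintype σ] (A : Set (σ → ℤ))
    (S : Finset σ) (w : σ → ℝ) (hw : ∀ a, 1 ≤ w a)
    (hbase : ∀ z ∈ A, ∀ a ∉ S, |(z a : ℝ)| ≤ w a)
    (hfib : ∀ z ∈ A, ∀ z' ∈ A, (∀ a ∉ S, z a = z' a) → ∀ a ∈ S, |(z a : ℝ) - z' a| ≤ w a) :
    A.Finite ∧ (A.ncard : ℝ) ≤ ∏ a, 3 * w a := by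
  classical
  let p : (σ → ℤ) → σ → ℤ := fun z a => if a ∈ S then 0 else z a
  have hp : ∀ z z', p z = p z' → ∀ a ∉ S, z a = z' a := fun z z' h a ha => by
    simpa [p, ha] using congrFun h a
  have hrep : ∀ u, ∃ r, ∀ z ∈ A, p z = u → r ∈ A ∧ p r = u := fun u => by
    by_cases h : ∃ z ∈ A, p z = u
    · obtain ⟨z, hz, hu⟩ := h
      exact ⟨z, fun _ _ _ => ⟨hz, hu⟩⟩
    · exact ⟨0, fun z hz hu => (h ⟨z, hz, hu⟩).elim⟩
  choose r hr using hrep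
  let g : (σ → ℤ) → σ → ℤ := fun z a => if a ∈ S then z a - r (p z) a else z a
  let T : Finset (σ → ℤ) := Fintype.piFinset fun a => Finset.Icc (-⌊w a⌋) ⌊w a⌋
  have hmaps : ∀ z ∈ A, g z ∈ (T : Set (σ → ℤ)) := fun z hz => by
    rw [Finset.mem_coe, Fintype.mem_piFinset]
    intro a
    have habs : |((g z a : ℤ) : ℝ)| ≤ w a := by
      by_cases ha : a ∈ S
      · obtain ⟨h1, h2⟩ := hr (p z) z hz rfl
        simpa [g, ha] using hfib z hz _ h1 (hp _ _ h2.symm) a ha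
      · simpa [g, ha] using hbase z hz a ha
    rw [← Int.cast_abs, ← Int.le_floor, abs_le] at habs
    exact Finset.mem_Icc.2 habs
  have hinj : Set.InjOn g A := fun z _ z' _ h => by
    have hpp : p z = p z' := by
      ext a
      by_cases ha : a ∈ S
      · simp [p, ha]
      · simpa [g, p, ha] using congrFun h a
    ext a
    by_cases ha : a ∈ S
    · simpa [g, ha, hpp] using congrFun h a
    · exact hp _ _ hpp a ha
  refine ⟨Set.Finite.of_injOn hmaps hinj T.finite_toSet, ?_⟩
  have hcard := Set.ncard_le_ncard_of_injOn g hmaps hinj T.finite_toSet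
  rw [Set.ncard_coe_finset, Fintype.card_piFinset] at hcard
  calc (A.ncard : ℝ) ≤ ((∏ a, (Finset.Icc (-⌊w a⌋) ⌊w a⌋).card : ℕ) : ℝ) := by
        exact_mod_cast hcard
    _ = ∏ a, ((Finset.Icc (-⌊w a⌋) ⌊w a⌋).card : ℝ) := by push_cast; rfl
    _ ≤ ∏ a, 3 * w a := by
        refine Finset.prod_le_prod (fun _ _ => by positivity) fun a _ => ?_
        have h1 : (1 : ℤ) ≤ ⌊w a⌋ := Int.le_floor.2 (by simpa using hw a)
        have h2 : ((Finset.Icc (-⌊w a⌋) ⌊w a⌋).card : ℤ) = 2 * ⌊w a⌋ + 1 := by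
          rw [Int.card_Icc, Int.toNat_of_nonneg (by omega)]
          ring
        have h3 : ((Finset.Icc (-⌊w a⌋) ⌊w a⌋).card : ℝ) = 2 * ⌊w a⌋ + 1 := by
          exact_mod_cast h2
        rw [h3]
        linarith [Int.floor_le (w a), hw a]

variable {κ ι τ : Type*} [Fintype κ] [Fintype ι] [Fintype τ]

theorem finite_and_ncard_le_prod_of_fiber_curried (A : Set (κ → ι → ℤ))
    (S : Finset (κ × ι)) (w : κ × ι → ℝ) (hw : ∀ a, 1 ≤ w a)
    (hbase : ∀ z ∈ A, ∀ a ∉ S, |(z a.1 a.2 : ℝ)| ≤ w a)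
    (hfib : ∀ z ∈ A, ∀ z' ∈ A, (∀ a ∉ S, z a.1 a.2 = z' a.1 a.2) →
      ∀ a ∈ S, |(z a.1 a.2 : ℝ) - z' a.1 a.2| ≤ w a) :
    A.Finite ∧ (A.ncard : ℝ) ≤ ∏ a, 3 * w a := by
  have hinj : Function.Injective (Equiv.curry κ ι ℤ).symm := Equiv.injective _
  have h := finite_and_ncard_le_prod_of_fiber ((Equiv.curry κ ι ℤ).symm '' A) S w hw
    (by rintro - ⟨z, hz, rfl⟩ a ha; exact hbase z hz a ha)
    (by rintro - ⟨z, hz, rfl⟩ - ⟨z', hz', rfl⟩ h a ha; exact hfib z hz z' hz' h a ha)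
  rwa [Set.ncard_image_of_injective _ hinj, Set.finite_image_iff hinj.injOn] at h

/-- The integer matrix `x` viewed as a real one. -/
def toReal (x : κ → ι → ℤ) : κ → ι → ℝ := fun k i => x k i

theorem finite_and_ncard_le_of_norm_le (A : Set (κ → ι → ℤ)) (P : κ → ℝ) (hP : ∀ k, 1 ≤ P k)
    (hA : ∀ x ∈ A, ∀ k, ‖toReal x k‖ ≤ P k) :
    A.Finite ∧ (A.ncard : ℝ) ≤ (∏ k, 3 * P k) ^ Fintype.card ι := by
  have h := finite_and_ncard_le_prod_of_fiber_curried A ∅ (fun a => P a.1) (fun a => hP a.1)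
    (fun z hz a _ => (norm_le_pi_norm (toReal z a.1) a.2).trans (hA z hz a.1))
    (fun _ _ _ _ _ a ha => absurd ha (Finset.notMem_empty a))
  simpa only [Fintype.prod_prod_type, Finset.prod_const, Finset.prod_pow, Finset.card_univ]
    using h

/-- If the derivative of a multilinear pencil in the directions supported on `S` is injective at
a point, then near that point the pencil is expanding along those directions. -/
theorem exists_nhds_antilipschitz [DecidableEq κ]
    (M : τ → ContinuousMultilinearMap ℝ (fun _ : κ => ι → ℝ) (ι → ℝ)) (S : Finset (κ × ι))
    (β₀ : τ → ℝ) (x₀ : κ → ι → ℝ)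
    (hinj : ∀ u : κ → ι → ℝ, (∀ k i, (k, i) ∉ S → u k i = 0) →
        ∑ ρ, β₀ ρ • (M ρ).linearDeriv x₀ u = 0 → u = 0) :
    ∃ c : ℝ, 0 < c ∧ ∃ U ∈ 𝓝 (β₀, x₀), ∀ β x x', (β, x) ∈ U → (β, x') ∈ U →
      (∀ k i, (k, i) ∉ S → x k i = x' k i) →
      ‖x - x'‖ ≤ c * ‖∑ ρ, β ρ • M ρ x - ∑ ρ, β ρ • M ρ x'‖ := by
  let F : (τ → ℝ) × (κ → ι → ℝ) → ι → ℝ := fun p => ∑ ρ, p.1 ρ • M ρ p.2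
  have hF : HasStrictFDerivAt F _ (β₀, x₀) := HasStrictFDerivAt.fun_sum (u := Finset.univ)
    fun ρ _ => HasStrictFDerivAt.fun_smul
      (((ContinuousLinearMap.proj (R := ℝ) (φ := fun _ : τ => ℝ) ρ).hasStrictFDerivAt).comp
        (β₀, x₀) hasStrictFDerivAt_fst)
      (HasStrictFDerivAt.comp (β₀, x₀) ((M ρ).hasStrictFDerivAt x₀) hasStrictFDerivAt_snd)
  let W : Submodule ℝ (κ → ι → ℝ) :=
    { carrier := {u | ∀ k i, (k, i) ∉ S → u k i = 0}
      add_mem' := fun {a b} ha hb k i h => by simp [ha k i h, hb k i h]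
      zero_mem' := fun _ _ _ => rfl
      smul_mem' := fun c a ha k i h => by simp [ha k i h] }
  let D : W →ₗ[ℝ] ι → ℝ :=
    (∑ ρ, β₀ ρ • ((M ρ).linearDeriv x₀ : (κ → ι → ℝ) →L[ℝ] ι → ℝ)).toLinearMap ∘ₗ W.subtype
  have hD : ∀ u : W, D u = ∑ ρ, β₀ ρ • (M ρ).linearDeriv x₀ u := fun u => by
    simp [D]
  obtain ⟨K, hK, hanti⟩ := D.exists_antilipschitzWith <| by
    rw [LinearMap.ker_eq_bot']
    intro u hu
    rw [hD] at hu
    exact Subtype.ext (hinj u u.2 hu)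
  have hK' : (0 : ℝ) < K := hK
  have hlo := hF.isLittleO.def (c := (2 * (K : ℝ))⁻¹) (by positivity)
  rw [nhds_prod_eq] at hlo
  obtain ⟨U, hU, hUlo⟩ := Filter.mem_prod_same_iff.1 hlo
  refine ⟨2 * K, by positivity, U, hU, fun β x x' hx hx' hS => ?_⟩
  have h1 := hUlo (Set.mk_mem_prod hx hx')
  have hW : x - x' ∈ W := fun k i h => by simp [hS k i h]
  have h2 : ‖x - x'‖ ≤ K * ‖D ⟨x - x', hW⟩‖ := by
    simpa [dist_eq_norm] using hanti.le_mul_dist ⟨x - x', hW⟩ 0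
  have h3 : ‖(β, x) - (β, x')‖ = ‖x - x'‖ := by
    simp [Prod.norm_def]
  simp only [Set.mem_ofPred_eq, h3] at h1
  have h4 : ‖F (β, x) - F (β, x') - D ⟨x - x', hW⟩‖ ≤ (2 * (K : ℝ))⁻¹ * ‖x - x'‖ := by
    refine le_trans (le_of_eq ?_) h1
    congr 2
    rw [hD]
    simp
  have h5 : ‖D ⟨x - x', hW⟩‖ ≤ ‖F (β, x) - F (β, x')‖ + (2 * (K : ℝ))⁻¹ * ‖x - x'‖ := by
    have := norm_sub_norm_le (D ⟨x - x', hW⟩) (F (β, x) - F (β, x'))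
    rw [norm_sub_rev (D _)] at this
    linarith
  have h6 : (K : ℝ) * ((2 * (K : ℝ))⁻¹ * ‖x - x'‖) = ‖x - x'‖ / 2 := by
    field_simp
  have h7 := mul_le_mul_of_nonneg_left h5 hK'.le
  change _ ≤ 2 * K * ‖F (β, x) - F (β, x')‖
  nlinarith

theorem pow_mul_pow_div_le {B Q : ℝ} (hB : 1 ≤ B) (hQ : 0 < Q) {e n s σ : ℕ}
    (hQB : Q ≤ B ^ (e + 1)) (hs : s ≤ n) (hn : n ≤ s + σ) :
    Q ^ n * (B ^ e / Q) ^ s ≤ B ^ (e * n + σ) := by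
  obtain ⟨t, rfl⟩ := Nat.exists_eq_add_of_le hs
  have hB0 : 0 < B := by linarith
  calc Q ^ (s + t) * (B ^ e / Q) ^ s = Q ^ t * (B ^ e) ^ s := by
        rw [div_pow, pow_add]
        field_simp
    _ ≤ (B ^ (e + 1)) ^ t * (B ^ e) ^ s := by gcongr
    _ = B ^ (e * (s + t) + t) := by
        rw [← pow_mul, ← pow_mul, ← pow_add]
        congr 1
        ring
    _ ≤ B ^ (e * (s + t) + σ) := pow_le_pow_right₀ hB (by omega)

/-- The integer points of the box with side lengths `2 * P k` whose rescaling lies in the region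
`s` at the parameter `β`, and where the pencil `β • M` takes a value of size at most `A`. -/
def boxPoints (M : τ → ContinuousMultilinearMap ℝ (fun _ : κ => ι → ℝ) (ι → ℝ))
    (s : Set ((τ → ℝ) × (κ → ι → ℝ))) (β : τ → ℝ) (P : κ → ℝ) (A : ℝ) : Set (κ → ι → ℤ) :=
  {x | (∀ k, ‖toReal x k‖ ≤ 2 * P k) ∧ (β, fun k => (P k)⁻¹ • toReal x k) ∈ s ∧
    ‖∑ ρ, β ρ • M ρ (toReal x)‖ ≤ A}

theorem finite_and_ncard_boxPoints_le
    (M : τ → ContinuousMultilinearMap ℝ (fun _ : κ => ι → ℝ) (ι → ℝ))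
    (s : Set ((τ → ℝ) × (κ → ι → ℝ))) (β : τ → ℝ) (P : κ → ℝ) (hP : ∀ k, 1 ≤ P k) (A : ℝ) :
    (boxPoints M s β P A).Finite ∧
      ((boxPoints M s β P A).ncard : ℝ) ≤ (∏ k, 3 * (2 * P k)) ^ Fintype.card ι :=
  finite_and_ncard_le_of_norm_le _ (fun k => 2 * P k) (fun k => by linarith [hP k])
    fun _ hx => hx.1

theorem sum_smul_apply_inv_smul {κ ι τ : Type*} [Fintype κ] [Fintype τ]
    (M : τ → ContinuousMultilinearMap ℝ (fun _ : κ => ι → ℝ) (ι → ℝ)) (β : τ → ℝ) (P : κ → ℝ)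
    (x : κ → ι → ℝ) :
    ∑ ρ, β ρ • M ρ (fun k => (P k)⁻¹ • x k) = (∏ k, P k)⁻¹ • ∑ ρ, β ρ • M ρ x := by
  simp only [ContinuousMultilinearMap.map_smul_univ, Finset.smul_sum, Finset.prod_inv_distrib]
  exact Finset.sum_congr rfl fun ρ _ => smul_comm _ _ _

/-- The region `s` carries at most `O(B ^ (e * n + σ))` points, uniformly in the parameter and in
the box. -/
def HasBoxBound (M : τ → ContinuousMultilinearMap ℝ (fun _ : κ => ι → ℝ) (ι → ℝ)) (e σ : ℕ)
    (c₀ : ℝ) (s : Set ((τ → ℝ) × (κ → ι → ℝ))) : Prop :=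
  ∃ C : ℝ, 0 < C ∧ ∀ (β : τ → ℝ) (P : κ → ℝ) (B : ℝ), (∀ k, 1 ≤ P k) → (∀ k, P k ≤ B) → 1 ≤ B →
    ((boxPoints M s β P (c₀ * B ^ e)).ncard : ℝ) ≤ C * B ^ (e * Fintype.card ι + σ)

theorem continuous_pencil {κ ι τ : Type*} [Fintype τ]
    (M : τ → ContinuousMultilinearMap ℝ (fun _ : κ => ι → ℝ) (ι → ℝ)) :
    Continuous fun p : (τ → ℝ) × (κ → ι → ℝ) => ∑ ρ, p.1 ρ • M ρ p.2 :=
  continuous_finsetSum _ fun ρ _ =>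
    ((continuous_apply ρ).comp continuous_fst).smul ((M ρ).cont.comp continuous_snd)

theorem exists_hasBoxBound_of_ne_zero
    (M : τ → ContinuousMultilinearMap ℝ (fun _ : κ => ι → ℝ) (ι → ℝ)) (e σ : ℕ) {c₀ : ℝ}
    (hc₀ : 0 < c₀) (p : (τ → ℝ) × (κ → ι → ℝ)) (hp : ∑ ρ, p.1 ρ • M ρ p.2 ≠ 0) :
    ∃ t ∈ 𝓝 p, HasBoxBound M e σ c₀ t := by
  set c := ‖∑ ρ, p.1 ρ • M ρ p.2‖ / 2 with hc
  have hpos : 0 < ‖∑ ρ, p.1 ρ • M ρ p.2‖ := norm_pos_iff.2 hp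
  have hc0 : 0 < c := by positivity
  refine ⟨{q | c < ‖∑ ρ, q.1 ρ • M ρ q.2‖},
    ((continuous_pencil M).norm.tendsto p).eventually (lt_mem_nhds (by linarith)),
    (6 ^ Fintype.card κ * (c₀ / c)) ^ Fintype.card ι, by positivity, fun β P B hP hPB hB => ?_⟩
  have hB0 : 0 < B := by linarith
  have hQ : 0 < ∏ k, P k := Finset.prod_pos fun k _ => by linarith [hP k]
  rcases (boxPoints M _ β P (c₀ * B ^ e)).eq_empty_or_nonempty with h | ⟨x, -, hx, hx'⟩
  · rw [h, Set.ncard_empty, Nat.cast_zero]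
    positivity
  · rw [Set.mem_ofPred_eq] at hx
    rw [sum_smul_apply_inv_smul, norm_smul, norm_inv, Real.norm_of_nonneg hQ.le,
      ← div_eq_inv_mul, lt_div_iff₀ hQ] at hx
    have hQB : ∏ k, P k ≤ c₀ / c * B ^ e := by
      rw [div_mul_eq_mul_div, le_div_iff₀ hc0]
      linarith
    refine (finite_and_ncard_boxPoints_le M _ β P hP _).2.trans ?_
    calc (∏ k, 3 * (2 * P k)) ^ Fintype.card ι
        = (6 ^ Fintype.card κ * ∏ k, P k) ^ Fintype.card ι := by
          simp only [← mul_assoc, Finset.prod_mul_distrib, Finset.prod_const, Finset.card_univ,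
            ← mul_pow]
          norm_num
      _ ≤ (6 ^ Fintype.card κ * (c₀ / c * B ^ e)) ^ Fintype.card ι := by gcongr
      _ = (6 ^ Fintype.card κ * (c₀ / c)) ^ Fintype.card ι * B ^ (e * Fintype.card ι) := by
          rw [← mul_assoc, mul_pow, pow_mul]
      _ ≤ _ := by
          gcongr
          omega

theorem exists_hasBoxBound_of_injective [DecidableEq κ]
    (M : τ → ContinuousMultilinearMap ℝ (fun _ : κ => ι → ℝ) (ι → ℝ)) {e σ : ℕ}
    (he : Fintype.card κ = e + 1) {c₀ : ℝ} (β₀ : τ → ℝ) (x₀ : κ → ι → ℝ) (S : Finset (κ × ι))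
    (hS : S.card ≤ Fintype.card ι) (hS' : Fintype.card ι ≤ S.card + σ)
    (hinj : ∀ u : κ → ι → ℝ, (∀ k i, (k, i) ∉ S → u k i = 0) →
        ∑ ρ, β₀ ρ • (M ρ).linearDeriv x₀ u = 0 → u = 0) :
    ∃ t ∈ 𝓝 (β₀, x₀), HasBoxBound M e σ c₀ t := by
  classical
  obtain ⟨c, hc, U, hU, hanti⟩ := exists_nhds_antilipschitz M S β₀ x₀ hinj
  set L := max 1 (c * c₀)
  have hL1 : 1 ≤ L := le_max_left _ _
  have hLc : c * c₀ ≤ L := le_max_right _ _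
  refine ⟨U, hU, (3 * (2 * L)) ^ Fintype.card (κ × ι), by positivity,
    fun β P B hP hPB hB => ?_⟩
  have hB0 : 0 < B := by linarith
  have hP0 : ∀ k, 0 < P k := fun k => by linarith [hP k]
  have hQ : 0 < ∏ k, P k := Finset.prod_pos fun k _ => hP0 k
  have hQB : ∏ k, P k ≤ B ^ (e + 1) := by
    rw [← he, ← Finset.card_univ, ← Finset.prod_const]
    exact Finset.prod_le_prod (fun k _ => (hP0 k).le) fun k _ => hPB k
  set δ := B ^ e / ∏ k, P k with hδ
  have hδP : ∀ k, 1 ≤ P k * δ := fun k => by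
    rw [hδ, ← mul_div_assoc, one_le_div hQ, ← Finset.mul_prod_erase _ _ (Finset.mem_univ k)]
    refine mul_le_mul_of_nonneg_left ?_ (hP0 k).le
    have hcard : (Finset.univ.erase k).card = e := by
      rw [Finset.card_erase_of_mem (Finset.mem_univ k), Finset.card_univ, he]
      rfl
    rw [← hcard, ← Finset.prod_const]
    exact Finset.prod_le_prod (fun k _ => (hP0 k).le) fun k _ => hPB k
  have hbound := (finite_and_ncard_le_prod_of_fiber_curried (boxPoints M U β P (c₀ * B ^ e)) S
    (fun a => 2 * L * (P a.1 * if a ∈ S then δ else 1)) (fun a => ?_) (fun z hz a ha => ?_)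
    fun z hz z' hz' h a ha => ?_).2
  · refine hbound.trans ?_
    have h1 : ∏ a : κ × ι, P a.1 = (∏ k, P k) ^ Fintype.card ι := by
      simp only [Fintype.prod_prod_type, Finset.prod_const, Finset.prod_pow, Finset.card_univ]
    have h2 : ∏ a : κ × ι, (if a ∈ S then δ else 1) = δ ^ S.card := by
      rw [Finset.prod_ite_mem, Finset.univ_inter, Finset.prod_const]
    simp only [← mul_assoc]
    simp only [mul_assoc (3 * 2 * L), Finset.prod_mul_distrib, Finset.prod_const,
      Finset.card_univ, h1, h2, ← mul_pow]
    rw [mul_assoc]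
    exact mul_le_mul_of_nonneg_left (pow_mul_pow_div_le hB hQ hQB hS hS') (by positivity)
  · split_ifs
    · nlinarith [hδP a.1]
    · nlinarith [hP a.1]
  · rw [if_neg ha, mul_one]
    refine (norm_le_pi_norm (toReal z a.1) a.2).trans ((hz.1 a.1).trans ?_)
    nlinarith [hP a.1]
  · rw [if_pos ha]
    have h1 := hanti β _ _ hz.2.1 hz'.2.1 fun k i hki => by
      simp [toReal, h (k, i) hki]
    rw [sum_smul_apply_inv_smul, sum_smul_apply_inv_smul, ← smul_sub, norm_smul, norm_inv,
      Real.norm_of_nonneg hQ.le] at h1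
    have h2 := norm_sub_le_of_le hz.2.2 hz'.2.2
    have h3 : |(P a.1)⁻¹ * z a.1 a.2 - (P a.1)⁻¹ * z' a.1 a.2| ≤
        c * ((∏ k, P k)⁻¹ * (c₀ * B ^ e + c₀ * B ^ e)) :=
      ((norm_le_pi_norm (((fun k => (P k)⁻¹ • toReal z k) - fun k => (P k)⁻¹ • toReal z' k) a.1)
        a.2).trans (norm_le_pi_norm _ a.1)).trans (h1.trans (by gcongr))
    rw [← mul_sub, abs_mul, abs_inv, abs_of_pos (hP0 a.1), ← div_eq_inv_mul,
      div_le_iff₀ (hP0 a.1)] at h3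
    calc _ ≤ _ := h3
      _ = 2 * (c * c₀) * (P a.1 * δ) := by rw [hδ]; ring
      _ ≤ 2 * L * (P a.1 * δ) := by
        have := hδP a.1
        gcongr

theorem hasBoxBound_of_isCompact
    (M : τ → ContinuousMultilinearMap ℝ (fun _ : κ => ι → ℝ) (ι → ℝ)) {e σ : ℕ} {c₀ : ℝ}
    {K : Set ((τ → ℝ) × (κ → ι → ℝ))} (hK : IsCompact K)
    (hloc : ∀ p ∈ K, ∃ t ∈ 𝓝 p, HasBoxBound M e σ c₀ t) : HasBoxBound M e σ c₀ K := by
  refine hK.induction_on ⟨1, one_pos, fun β P B _ _ hB => ?_⟩ ?_ ?_ fun p hp => ?_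
  · have : boxPoints M ∅ β P (c₀ * B ^ e) = ∅ :=
      Set.eq_empty_of_forall_notMem fun x hx => hx.2.1
    rw [this, Set.ncard_empty, Nat.cast_zero]
    positivity
  · rintro s t hst ⟨C, hC, h⟩
    refine ⟨C, hC, fun β P B hP hPB hB => le_trans ?_ (h β P B hP hPB hB)⟩
    have hsub : boxPoints M s β P (c₀ * B ^ e) ⊆ boxPoints M t β P (c₀ * B ^ e) := fun x hx =>
      ⟨hx.1, hst hx.2.1, hx.2.2⟩
    exact_mod_cast Set.ncard_le_ncard hsub (finite_and_ncard_boxPoints_le M t β P hP _).1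
  · rintro s t ⟨C, hC, h⟩ ⟨C', hC', h'⟩
    refine ⟨C + C', by positivity, fun β P B hP hPB hB => ?_⟩
    have hsub : boxPoints M (s ∪ t) β P (c₀ * B ^ e) ⊆
        boxPoints M s β P (c₀ * B ^ e) ∪ boxPoints M t β P (c₀ * B ^ e) := fun x hx =>
      hx.2.1.imp (fun hs => ⟨hx.1, hs, hx.2.2⟩) fun ht => ⟨hx.1, ht, hx.2.2⟩
    have hcard := (Set.ncard_le_ncard hsub ((finite_and_ncard_boxPoints_le M s β P hP _).1.union
      (finite_and_ncard_boxPoints_le M t β P hP _).1)).trans (Set.ncard_union_le _ _)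
    have hcard' : ((boxPoints M (s ∪ t) β P (c₀ * B ^ e)).ncard : ℝ) ≤
        (boxPoints M s β P (c₀ * B ^ e)).ncard + (boxPoints M t β P (c₀ * B ^ e)).ncard := by
      exact_mod_cast hcard
    linarith [h β P B hP hPB hB, h' β P B hP hPB hB]
  · obtain ⟨t, ht, h⟩ := hloc p hp
    exact ⟨t, mem_nhdsWithin_of_mem_nhds ht, h⟩


theorem isCompact_sphere_prod_pi_annulus {κ ι τ : Type*} [Fintype ι] [Fintype τ] : IsCompact
    (Metric.sphere (0 : τ → ℝ) 1 ×ˢ {x : κ → ι → ℝ | ∀ k, 1 ≤ ‖x k‖ ∧ ‖x k‖ ≤ 2}) := by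
  refine (isCompact_sphere 0 1).prod ?_
  have : {x : κ → ι → ℝ | ∀ k, 1 ≤ ‖x k‖ ∧ ‖x k‖ ≤ 2} =
      Set.univ.pi fun _ : κ => Metric.closedBall (0 : ι → ℝ) 2 \ Metric.ball 0 1 := by
    ext x
    simp [Set.mem_pi, and_comm]
  rw [this]
  exact isCompact_univ_pi fun _ => (isCompact_closedBall 0 2).diff Metric.isOpen_ball

theorem ncard_le_of_exists_eq_zero {e : ℕ} (he : Fintype.card κ = e + 1) {B : ℝ} (hB : 1 ≤ B) :
    {x : κ → ι → ℤ | (∀ k, ‖toReal x k‖ ≤ B) ∧ ∃ k, x k = 0}.Finite ∧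
      ({x : κ → ι → ℤ | (∀ k, ‖toReal x k‖ ≤ B) ∧ ∃ k, x k = 0}.ncard : ℝ) ≤
        (e + 1) * (3 ^ (e + 1)) ^ Fintype.card ι * B ^ (e * Fintype.card ι) := by
  classical
  have hk : ∀ k₀ : κ, {x : κ → ι → ℤ | (∀ k, ‖toReal x k‖ ≤ B) ∧ x k₀ = 0}.Finite ∧
      ({x : κ → ι → ℤ | (∀ k, ‖toReal x k‖ ≤ B) ∧ x k₀ = 0}.ncard : ℝ) ≤
        (3 ^ (e + 1)) ^ Fintype.card ι * B ^ (e * Fintype.card ι) := fun k₀ => by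
    have h := finite_and_ncard_le_of_norm_le
      {x : κ → ι → ℤ | (∀ k, ‖toReal x k‖ ≤ B) ∧ x k₀ = 0} (fun k => if k = k₀ then 1 else B)
      (fun k => by split_ifs <;> linarith) fun x hx k => by
        split_ifs with h
        · have : toReal x k = 0 := by
            ext i
            simp [toReal, h, hx.2]
          simp [this]
        · exact hx.1 k
    refine ⟨h.1, h.2.trans_eq ?_⟩
    rw [Finset.prod_mul_distrib, Finset.prod_const, Finset.card_univ, he, mul_pow, pow_mul,
      ← Finset.mul_prod_erase _ _ (Finset.mem_univ k₀), if_pos rfl, one_mul,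
      Finset.prod_congr rfl fun k hk => if_neg (Finset.ne_of_mem_erase hk), Finset.prod_const,
      Finset.card_erase_of_mem (Finset.mem_univ k₀), Finset.card_univ, he, Nat.add_sub_cancel]
  have hU : {x : κ → ι → ℤ | (∀ k, ‖toReal x k‖ ≤ B) ∧ ∃ k, x k = 0} =
      ⋃ k₀ ∈ (Finset.univ : Finset κ), {x : κ → ι → ℤ | (∀ k, ‖toReal x k‖ ≤ B) ∧ x k₀ = 0} := by
    ext x
    simp
  rw [hU]
  refine ⟨(Finset.univ : Finset κ).finite_toSet.biUnion fun k _ => (hk k).1, ?_⟩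
  calc _ ≤ ((∑ k₀ : κ, {x : κ → ι → ℤ | (∀ k, ‖toReal x k‖ ≤ B) ∧ x k₀ = 0}.ncard : ℕ) : ℝ) :=
        Nat.cast_le.2 (Finset.set_ncard_biUnion_le _ _)
    _ ≤ ∑ _k₀ : κ, (3 ^ (e + 1)) ^ Fintype.card ι * B ^ (e * Fintype.card ι) := by
        rw [Nat.cast_sum]
        exact Finset.sum_le_sum fun k _ => (hk k).2
    _ = _ := by
        rw [Finset.sum_const, Finset.card_univ, he, nsmul_eq_mul]
        push_cast
        ring

theorem one_le_norm_toReal {κ ι : Type*} [Fintype ι] {x : κ → ι → ℤ} {k : κ} (hx : x k ≠ 0) : 1 ≤ ‖toReal x k‖ := by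
  obtain ⟨i, hi⟩ := Function.ne_iff.1 hx
  refine le_trans ?_ (norm_le_pi_norm (toReal x k) i)
  have h : (1 : ℤ) ≤ |x k i| := Int.one_le_abs hi
  change (1 : ℝ) ≤ |(x k i : ℝ)|
  exact_mod_cast h

theorem natLog_two_floor_add_one_le {B : ℝ} (hB : 2 ≤ B) :
    ((Nat.log 2 ⌊B⌋₊ + 1 : ℕ) : ℝ) ≤ 2 / Real.log 2 * Real.log B := by
  have h2 : 0 < Real.log 2 := Real.log_pos one_lt_two
  have hfl : (2 : ℕ) ≤ ⌊B⌋₊ := Nat.le_floor (by exact_mod_cast hB)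
  have h1 : Real.log ⌊B⌋₊ ≤ Real.log B :=
    Real.log_le_log (by positivity) (Nat.floor_le (by linarith))
  have h3 : Real.log 2 ≤ Real.log B := Real.log_le_log two_pos hB
  have h4 := Real.natLog_le_logb ⌊B⌋₊ 2
  rw [← Real.log_div_log, Nat.cast_ofNat, le_div_iff₀ h2] at h4
  rw [div_mul_eq_mul_div, le_div_iff₀ h2]
  push_cast
  linarith

/-- Dyadic decomposition reducing the count of small values of a pencil of multilinear maps on
integer points to the count in boxes. -/
theorem exists_ncard_le_of_hasBoxBound
    (M : τ → ContinuousMultilinearMap ℝ (fun _ : κ => ι → ℝ) (ι → ℝ)) {e σ : ℕ}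
    (he : Fintype.card κ = e + 1) {c₀ : ℝ}
    (h : HasBoxBound M e σ c₀
      (Metric.sphere (0 : τ → ℝ) 1 ×ˢ {x : κ → ι → ℝ | ∀ k, 1 ≤ ‖x k‖ ∧ ‖x k‖ ≤ 2})) :
    ∃ C : ℝ, 0 < C ∧ ∀ (β : τ → ℝ) (B : ℝ), 2 ≤ B →
      {x : κ → ι → ℤ | (∀ k, ‖toReal x k‖ ≤ B) ∧
        ‖∑ ρ, β ρ • M ρ (toReal x)‖ < c₀ * ‖β‖ * B ^ e}.Finite ∧
      ({x : κ → ι → ℤ | (∀ k, ‖toReal x k‖ ≤ B) ∧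
        ‖∑ ρ, β ρ • M ρ (toReal x)‖ < c₀ * ‖β‖ * B ^ e}.ncard : ℝ) ≤
        C * B ^ (e * Fintype.card ι + σ) * Real.log B ^ (e + 1) := by
  classical
  obtain ⟨C, hC, h⟩ := h
  have hlog2 : 0 < Real.log 2 := Real.log_pos one_lt_two
  set C₀ : ℝ := (e + 1) * (3 ^ (e + 1)) ^ Fintype.card ι
  have hC₀0 : 0 < C₀ := by positivity
  refine ⟨(C₀ + C) * (2 / Real.log 2) ^ (e + 1), by positivity, fun β B hB => ?_⟩
  have hB1 : 1 ≤ B := by linarith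
  set K := Metric.sphere (0 : τ → ℝ) 1 ×ˢ {x : κ → ι → ℝ | ∀ k, 1 ≤ ‖x k‖ ∧ ‖x k‖ ≤ 2}
  set N := {x : κ → ι → ℤ | (∀ k, ‖toReal x k‖ ≤ B) ∧
        ‖∑ ρ, β ρ • M ρ (toReal x)‖ < c₀ * ‖β‖ * B ^ e}
  set Z := {x : κ → ι → ℤ | (∀ k, ‖toReal x k‖ ≤ B) ∧ ∃ k, x k = 0}
  set T : Finset (κ → ℕ) := Fintype.piFinset fun _ => Finset.range (Nat.log 2 ⌊B⌋₊ + 1) with hT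
  let β' : τ → ℝ := ‖β‖⁻¹ • β
  let Q : (κ → ℕ) → Set (κ → ι → ℤ) := fun l => boxPoints M K β' (fun k => 2 ^ l k) (c₀ * B ^ e)
  have hQfin : ∀ l, (Q l).Finite := fun l =>
    (finite_and_ncard_boxPoints_le M K β' _ (fun k => one_le_pow₀ one_le_two) _).1
  have hZb := ncard_le_of_exists_eq_zero (ι := ι) he hB1
  have hsub : N ⊆ Z ∪ ⋃ l ∈ T, Q l := by
    rintro x ⟨hx, hval⟩
    by_cases hx0 : ∃ k, x k = 0
    · exact Or.inl ⟨hx, hx0⟩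
    push Not at hx0
    have hβ : 0 < ‖β‖ := by
      refine norm_pos_iff.2 fun h0 => ?_
      simp [h0] at hval
    have hfl : ∀ k, 1 ≤ ⌊‖toReal x k‖⌋₊ := fun k =>
      Nat.le_floor (by simpa using one_le_norm_toReal (hx0 k))
    have hlow : ∀ k, (2 : ℝ) ^ Nat.log 2 ⌊‖toReal x k‖⌋₊ ≤ ‖toReal x k‖ := fun k => by
      refine le_trans ?_ (Nat.floor_le (norm_nonneg _))
      exact_mod_cast Nat.pow_log_le_self 2 (Nat.one_le_iff_ne_zero.1 (hfl k))
    have hupp : ∀ k, ‖toReal x k‖ ≤ 2 * 2 ^ Nat.log 2 ⌊‖toReal x k‖⌋₊ := fun k => by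
      refine (Nat.lt_floor_add_one _).le.trans ?_
      have := Nat.lt_pow_succ_log_self one_lt_two ⌊‖toReal x k‖⌋₊
      rw [Nat.succ_eq_add_one, pow_succ'] at this
      exact_mod_cast this
    refine Or.inr (Set.mem_biUnion (x := fun k => Nat.log 2 ⌊‖toReal x k‖⌋₊) ?_
      ⟨hupp, ⟨?_, fun k => ?_⟩, ?_⟩)
    · rw [hT, Finset.mem_coe, Fintype.mem_piFinset]
      exact fun k => Finset.mem_range_succ_iff.2 (Nat.log_mono_right (Nat.floor_mono (hx k)))
    · rw [mem_sphere_zero_iff_norm, norm_smul, norm_inv, norm_norm, inv_mul_cancel₀ hβ.ne']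
    · have hp : (0 : ℝ) < 2 ^ Nat.log 2 ⌊‖toReal x k‖⌋₊ := by positivity
      simp only [norm_smul, norm_inv, Real.norm_of_nonneg hp.le, ← div_eq_inv_mul]
      exact ⟨(one_le_div hp).2 (hlow k), (div_le_iff₀ hp).2 (hupp k)⟩
    · have : ∑ ρ, β' ρ • M ρ (toReal x) = ‖β‖⁻¹ • ∑ ρ, β ρ • M ρ (toReal x) := by
        simp only [β', Pi.smul_apply, smul_assoc, Finset.smul_sum]
      rw [this, norm_smul, norm_inv, norm_norm, ← div_eq_inv_mul, div_le_iff₀ hβ]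
      linarith
  have hfin : (Z ∪ ⋃ l ∈ T, Q l).Finite :=
    hZb.1.union (T.finite_toSet.biUnion fun l _ => hQfin l)
  refine ⟨hfin.subset hsub, ?_⟩
  have hQb : ∀ l ∈ T, ((Q l).ncard : ℝ) ≤ C * B ^ (e * Fintype.card ι + σ) := fun l hl => by
    refine h β' _ B (fun k => one_le_pow₀ one_le_two) (fun k => ?_) hB1
    have hlk := Finset.mem_range_succ_iff.1 (Fintype.mem_piFinset.1 hl k)
    have hfl : ⌊B⌋₊ ≠ 0 := (Nat.floor_pos.2 hB1).ne'
    refine le_trans ?_ (Nat.floor_le (by linarith : 0 ≤ B))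
    exact_mod_cast Nat.pow_le_of_le_log hfl hlk
  have hTcard : (T.card : ℝ) ≤ (2 / Real.log 2 * Real.log B) ^ (e + 1) := by
    rw [hT, Fintype.card_piFinset, Finset.prod_const, Finset.card_range, Finset.card_univ, he,
      Nat.cast_pow]
    exact pow_le_pow_left₀ (Nat.cast_nonneg _) (natLog_two_floor_add_one_le hB) _
  have hone : 1 ≤ (2 / Real.log 2 * Real.log B) ^ (e + 1) :=
    one_le_pow₀ (le_trans (by simp) (natLog_two_floor_add_one_le hB))
  have hN1 : (N.ncard : ℝ) ≤ Z.ncard + ∑ l ∈ T, ((Q l).ncard : ℝ) := by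
    have h1 := (Set.ncard_le_ncard hsub hfin).trans ((Set.ncard_union_le _ _).trans
      (Nat.add_le_add_left (Finset.set_ncard_biUnion_le T Q) _))
    exact_mod_cast h1
  have hZ1 : (Z.ncard : ℝ) ≤
      C₀ * B ^ (e * Fintype.card ι + σ) * (2 / Real.log 2 * Real.log B) ^ (e + 1) := by
    have hpw : B ^ (e * Fintype.card ι) ≤ B ^ (e * Fintype.card ι + σ) :=
      pow_le_pow_right₀ hB1 (Nat.le_add_right _ _)
    refine (hZb.2.trans (mul_le_mul_of_nonneg_left hpw hC₀0.le)).trans ?_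
    exact le_mul_of_one_le_right (by positivity) hone
  have hQ1 : ∑ l ∈ T, ((Q l).ncard : ℝ) ≤
      (2 / Real.log 2 * Real.log B) ^ (e + 1) * (C * B ^ (e * Fintype.card ι + σ)) := by
    refine (Finset.sum_le_sum hQb).trans ?_
    rw [Finset.sum_const, nsmul_eq_mul]
    exact mul_le_mul_of_nonneg_right hTcard (by positivity)
  rw [mul_pow] at hZ1 hQ1
  linarith

end Counting

/-- Bound for the number of solutions of the auxiliary
inequality in terms of `σ*` of the system of leading forms. -/
theorem statement2 (d R n : ℕ) (hd : 2 ≤ d) (hR : 1 ≤ R) (hn : 1 ≤ n)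
    (f : Fin R → MvPolynomial (Fin n) ℝ)
    (hdeg : ∀ ρ, (f ρ).totalDegree = d) :
    ∃ C : ℝ, 0 < C ∧ ∀ (β : Fin R → ℝ) (B : ℝ), 2 ≤ B →
      (Naux d n (∑ ρ, β ρ • f ρ) B : ℝ) ≤
        C * B ^ ((d - 2) * n +
            sigmaStarR d n R (fun ρ => MvPolynomial.homogeneousComponent d (f ρ)))
          * Real.log B ^ (d - 1) := by
  have he : Fintype.card (Fin (d - 1)) = (d - 2) + 1 := by
    rw [Fintype.card_fin]
    omega
  obtain ⟨c₀, hc₀, hnorm⟩ := normFd_sum_smul_le (d := d) f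
  let M : Fin R → ContinuousMultilinearMap ℝ (fun _ : Fin (d - 1) => Fin n → ℝ) (Fin n → ℝ) :=
    fun ρ => mFormMultilinear d n (f ρ)
  set σ := sigmaStarR d n R (fun ρ => MvPolynomial.homogeneousComponent d (f ρ))
  have hbox : HasBoxBound M (d - 2) σ c₀ (Metric.sphere (0 : Fin R → ℝ) 1 ×ˢ
      {x : Fin (d - 1) → Fin n → ℝ | ∀ k, 1 ≤ ‖x k‖ ∧ ‖x k‖ ≤ 2}) := by
    refine hasBoxBound_of_isCompact M isCompact_sphere_prod_pi_annulus ?_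
    rintro ⟨β₀, x₀⟩ ⟨hβ₀, hx₀⟩
    by_cases h0 : ∑ ρ, β₀ ρ • M ρ x₀ = 0
    · obtain ⟨S, hS, hS', hinj⟩ := exists_finset_linearDeriv_injective (by omega) f
        (ne_zero_of_mem_unit_sphere ⟨β₀, hβ₀⟩)
        (fun k hk => by simpa [hk] using zero_lt_one.trans_le (hx₀ k).1) h0
      exact exists_hasBoxBound_of_injective M he β₀ x₀ S (by rwa [Fintype.card_fin])
        (by rwa [Fintype.card_fin]) hinj
    · exact exists_hasBoxBound_of_ne_zero M (d - 2) σ hc₀ (β₀, x₀) h0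
  obtain ⟨C, hC, hbound⟩ := exists_ncard_le_of_hasBoxBound M he hbox
  rw [Fintype.card_fin, show d - 2 + 1 = d - 1 by omega] at hbound
  refine ⟨C, hC, fun β B hB => le_trans ?_ (hbound β B hB).2⟩
  refine Nat.cast_le.2 (Set.ncard_le_ncard (fun x hx => ⟨hx.1, ?_⟩) (hbound β B hB).1)
  have hB0 : 0 ≤ B ^ (d - 2) := pow_nonneg (by linarith) _
  have hval := hx.2.trans_le (mul_le_mul_of_nonneg_right (hnorm β) hB0)
  rw [mForm_sum_smul] at hval
  simp only [M, mFormMultilinear_apply]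
  exact hval
end

section
/- Fix integers d ≥ 2, R ≥ 1 and n ≥ R. Identify each system H = (H_1,…,H_R) of homogeneous forms of degree d in n variables with rational coefficients with its coefficient vector in ℚ^N, where N = R·binom(n+d−1, d) is the total number of coefficients. Then there exists a nonzero polynomial Φ in N variables with rational coefficients such that every such system H with σ*(H) ≥ R satisfies Φ(H) = 0. In particular, there exists a system H of R homogeneous forms of degree d in n variables with rational coefficients satisfying σ*(H) ≤ R − 1. -/
open MvPolynomial

/-- σ* for a system with rational coefficients. -/
noncomputable def sigmaStarQ (d n R : ℕ) (H : Fin R → MvPolynomial (Fin n) ℚ) : ℕ :=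
  sigmaStar d n R fun ρ => (H ρ).map (algebraMap ℚ ℂ)

/-- An algebraically independent family inside a field generated by a finite set is at most as
large as that set. -/
theorem AlgebraicIndependent.card_le_of_mem_adjoin {k K ι : Type*} [Field k] [Field K] [Algebra k K]
    [Fintype ι] {h : ι → K} (hh : AlgebraicIndependent k h) (S : Finset K)
    (hS : ∀ i, h i ∈ IntermediateField.adjoin k (S : Set K)) : Fintype.card ι ≤ S.card := by
  have hsub : Set.range h ⊆ (AlgebraicIndependent.matroid k K).closure (S : Set K) := by
    rw [AlgebraicIndependent.matroid_closure_eq]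
    rintro _ ⟨i, rfl⟩
    change IsAlgebraic (Algebra.adjoin k (S : Set K)) (h i)
    refine IntermediateField.adjoin_induction k
      (p := fun x _ => IsAlgebraic (Algebra.adjoin k (S : Set K)) x) ?_ ?_ ?_ ?_ ?_ (hS i)
    · intro x hx
      exact isAlgebraic_algebraMap (⟨x, Algebra.subset_adjoin hx⟩ : Algebra.adjoin k (S : Set K))
    · intro x
      exact isAlgebraic_algebraMap (algebraMap k (Algebra.adjoin k (S : Set K)) x)
    · intro x y _ _ hx hy
      exact hx.add hy
    · intro x _ hx
      exact hx.inv
    · intro x y _ _ hx hy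
      exact hx.mul hy
  have hind : (AlgebraicIndependent.matroid k K).Indep (Set.range h) :=
    AlgebraicIndependent.matroid_indep_iff.2 hh.coe_range
  have h1 := hind.encard_le_eRk_of_subset hsub
  rw [Matroid.eRk_closure_eq] at h1
  have h2 := h1.trans (Matroid.eRk_le_encard _ _)
  rw [Set.encard_coe_eq_coe_finsetCard, ← Set.image_univ, hh.injective.encard_image,
    Set.encard_univ, ENat.card_eq_coe_fintype_card] at h2
  exact_mod_cast h2

/-- A solution in `K` of a linearly independent system of linear equations with coefficients in a
subfield `F` is spanned over `F` by few elements. -/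
theorem exists_finset_span_of_linear_relations {k K ι κ : Type*} [Field k] [Field K] [Algebra k K]
    [Fintype ι] [Fintype κ] (F : IntermediateField k K) (h : ι → K) (τ : κ → ι → K)
    (hτF : ∀ a i, τ a i ∈ F) (hτ : LinearIndependent K τ) (hrel : ∀ a, ∑ i, τ a i * h i = 0) :
    ∃ C : Finset K, C.card + Fintype.card κ ≤ Fintype.card ι ∧
      ∀ i, h i ∈ Submodule.span F (C : Set K) := by
  classical
  let L : (ι → F) →ₗ[F] K := Fintype.linearCombination F h
  let τ' : κ → ι → F := fun a i => ⟨τ a i, hτF a i⟩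
  have hτ' : LinearIndependent F τ' := by
    have h1 : LinearIndependent F τ := hτ.restrict_scalars' F
    let emb : (ι → F) →ₗ[F] (ι → K) := LinearMap.compLeft (Algebra.linearMap F K) ι
    exact LinearIndependent.of_comp emb h1
  have hker : ∀ a, τ' a ∈ LinearMap.ker L := by
    intro a
    simpa [L, τ', Fintype.linearCombination_apply, IntermediateField.smul_def] using hrel a
  have hcard : Fintype.card κ ≤ Module.finrank F (LinearMap.ker L) := by
    have : LinearIndependent F (fun a => (⟨τ' a, hker a⟩ : LinearMap.ker L)) :=
      LinearIndependent.of_comp (LinearMap.ker L).subtype hτ'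
    exact this.fintype_card_le_finrank
  have hrn := LinearMap.finrank_range_add_finrank_ker L
  rw [Module.finrank_fintype_fun_eq_card] at hrn
  have : Module.Free F (LinearMap.range L) := Module.Free.of_divisionRing F _
  let b := Module.finBasis F (LinearMap.range L)
  refine ⟨Finset.univ.image fun j => (b j : K), ?_, ?_⟩
  · have := Finset.card_image_le (s := Finset.univ) (f := fun j => (b j : K))
    rw [Finset.card_univ, Fintype.card_fin] at this
    omega
  · intro i
    have hi : h i ∈ LinearMap.range L := ⟨Pi.single i 1, by
      simp [L, Fintype.linearCombination_apply, Pi.single_apply, ite_smul]⟩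
    have h2 : (⟨h i, hi⟩ : LinearMap.range L) ∈ Submodule.span F (Set.range b) := by
      rw [b.span_eq]; trivial
    have h3 := Submodule.mem_map_of_mem (f := (LinearMap.range L).subtype) h2
    rw [Submodule.map_span, ← Set.range_comp] at h3
    simpa [Function.comp_def] using h3

/-- If an algebraically independent family satisfies linearly independent linear relations whose
coefficients generate a field of small transcendence degree, then there are few relations. -/
theorem AlgebraicIndependent.card_relations_le {k K ι κ : Type*} [Field k] [Field K] [Algebra k K]
    [Fintype ι] [Fintype κ] {h : ι → K} (hh : AlgebraicIndependent k h) (S : Finset K)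
    (τ : κ → ι → K) (hτF : ∀ a i, τ a i ∈ IntermediateField.adjoin k (S : Set K))
    (hτ : LinearIndependent K τ) (hrel : ∀ a, ∑ i, τ a i * h i = 0) :
    Fintype.card κ ≤ S.card := by
  classical
  obtain ⟨C, hC, hspan⟩ := exists_finset_span_of_linear_relations _ h τ hτF hτ hrel
  have := hh.card_le_of_mem_adjoin (S ∪ C) fun i => by
    refine Submodule.span_induction
      (p := fun x _ => x ∈ IntermediateField.adjoin k ((S ∪ C : Finset K) : Set K))
      ?_ (zero_mem _) (fun x y _ _ hx hy => add_mem hx hy) ?_ (hspan i)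
    · intro x hx
      exact IntermediateField.subset_adjoin _ _ (by simp [Finset.mem_coe.1 hx])
    · intro a x _ hx
      rw [IntermediateField.smul_def]
      refine mul_mem ?_ hx
      exact IntermediateField.adjoin.mono _ _ _ (by simp) a.2
  have := Finset.card_union_le S C
  omega

/-- A family in a `k`-algebra not annihilated by any nonzero polynomial specialises to an
algebraically independent family in some field. -/
theorem exists_algHom_field_algebraicIndependent.{u, v, w} {k : Type u} {ι : Type w} {P : Type v}
    [Field k] [CommRing P] [Algebra k P] (h : ι → P) (hh : AlgebraicIndependent k h) :
    ∃ (K : Type v) (_ : Field K) (_ : Algebra k K) (g : P →ₐ[k] K),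
      AlgebraicIndependent k (g ∘ h) := by
  let S : Submonoid P := (nonZeroDivisors (MvPolynomial ι k)).map (aeval h : _ →ₐ[k] P)
  have hdis : Disjoint ((⊥ : Ideal P) : Set P) S := by
    rw [Set.disjoint_left]
    rintro x hx ⟨p, hp, rfl⟩
    have h0 : aeval h p = 0 := by simpa using hx
    exact nonZeroDivisors.ne_zero hp ((injective_iff_map_eq_zero _).1 hh p h0)
  obtain ⟨I, hI, -, hIS⟩ := Ideal.exists_le_prime_disjoint ⊥ S hdis
  refine ⟨FractionRing (P ⧸ I), inferInstance, inferInstance,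
    (IsScalarTower.toAlgHom k (P ⧸ I) (FractionRing (P ⧸ I))).comp (Ideal.Quotient.mkₐ k I), ?_⟩
  refine (injective_iff_map_eq_zero _).2 fun p hp => ?_
  by_contra hne
  rw [Function.comp_def, ← MvPolynomial.comp_aeval_apply] at hp
  have h1 : Ideal.Quotient.mk I (aeval h p) = 0 := by
    apply IsFractionRing.injective (P ⧸ I) (FractionRing (P ⧸ I))
    simpa using hp
  rw [Ideal.Quotient.eq_zero_iff_mem] at h1
  exact Set.disjoint_left.1 hIS h1 ⟨p, mem_nonZeroDivisors_of_ne_zero hne, rfl⟩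

/-- The linear form `∑ vᵢ Xᵢ`. -/
noncomputable def linForm {A : Type*} [CommSemiring A] {n : ℕ} (v : Fin n → A) :
    MvPolynomial (Fin n) A :=
  ∑ i, C (v i) * X i

theorem coeff_linForm {A : Type*} [CommSemiring A] {n : ℕ} (v : Fin n → A) (i : Fin n) :
    coeff (Finsupp.single i 1) (linForm v) = v i := by
  classical
  simp [linForm, coeff_sum, coeff_C_mul, coeff_X, Finsupp.single_left_inj]

theorem isHomogeneous_linForm {A : Type*} [CommSemiring A] {n : ℕ} (v : Fin n → A) :
    (linForm v).IsHomogeneous 1 :=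
  IsHomogeneous.sum _ _ _ fun i _ => by
    simpa using (isHomogeneous_C _ (v i)).mul (isHomogeneous_X _ i)

theorem linForm_smul {A : Type*} [CommSemiring A] {n : ℕ} (c : A) (v : Fin n → A) :
    linForm (c • v) = C c * linForm v := by
  simp [linForm, Finset.mul_sum, mul_assoc]

theorem map_linForm {A B : Type*} [CommSemiring A] [CommSemiring B] {n : ℕ} (g : A →+* B)
    (v : Fin n → A) : map g (linForm v) = linForm (fun i => g (v i)) := by
  simp [linForm]

theorem linForm_single {A : Type*} [CommSemiring A] {n : ℕ} (j : Fin n) :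
    linForm (Pi.single j (1 : A)) = X j := by
  classical
  simp [linForm, Pi.single_apply, apply_ite C, ite_mul]

theorem linForm_eq_zero_iff {A : Type*} [CommSemiring A] {n : ℕ} {v : Fin n → A} :
    linForm v = 0 ↔ v = 0 := by
  constructor
  · intro h
    funext i
    rw [← coeff_linForm v i, h]; simp
  · rintro rfl
    simp [linForm]

theorem prime_linForm {K : Type*} [Field K] {n : ℕ} {v : Fin n → K} (hv : v ≠ 0) :
    Prime (linForm v) := by
  refine Irreducible.prime (irreducible_of_totalDegree_eq_one ?_ ?_)
  · exact (isHomogeneous_linForm v).totalDegree (linForm_eq_zero_iff.not.2 hv)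
  · intro x hx
    obtain ⟨i, hi⟩ := Function.ne_iff.1 hv
    have := hx (Finsupp.single i 1)
    rw [coeff_linForm] at this
    exact isUnit_of_dvd_unit this (isUnit_iff_ne_zero.2 hi)

theorem eq_smul_of_linForm_dvd {K : Type*} [Field K] {n : ℕ} {v u : Fin n → K}
    (h : linForm v ∣ linForm u) : ∃ c : K, u = c • v := by
  by_cases hu : u = 0
  · exact ⟨0, by simp [hu]⟩
  obtain ⟨q, hq⟩ := h
  have hu' := linForm_eq_zero_iff.not.2 hu
  have hv' : linForm v ≠ 0 := by rintro h0; simp [h0] at hq; exact hu' hq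
  have hq' : q ≠ 0 := by rintro h0; simp [h0] at hq; exact hu' hq
  have hdeg := congrArg totalDegree hq
  rw [totalDegree_mul_of_isDomain hv' hq', (isHomogeneous_linForm v).totalDegree hv',
    (isHomogeneous_linForm u).totalDegree hu'] at hdeg
  have hq0 : q.totalDegree = 0 := by omega
  rw [totalDegree_eq_zero_iff_eq_C] at hq0
  refine ⟨coeff 0 q, ?_⟩
  funext i
  rw [hq0] at hq
  have := congrArg (coeff (Finsupp.single i 1)) hq
  rw [mul_comm, coeff_C_mul, coeff_linForm, coeff_linForm] at this
  simpa using this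

/-- The product of all but one of a family of linear forms, times a variable. -/
noncomputable def omitProd {A : Type*} [CommSemiring A] {n : ℕ} {ι : Type*} [Fintype ι]
    [DecidableEq ι] (z : ι → Fin n → A) (k : ι) (j : Fin n) : MvPolynomial (Fin n) A :=
  (∏ l ∈ Finset.univ.erase k, linForm (z l)) * X j

theorem isHomogeneous_omitProd {A : Type*} [CommSemiring A] {n : ℕ} {ι : Type*} [Fintype ι]
    [DecidableEq ι] (z : ι → Fin n → A) (k : ι) (j : Fin n) :
    (omitProd z k j).IsHomogeneous (Fintype.card ι) := by
  have h1 := IsHomogeneous.prod (Finset.univ.erase k) (fun l => linForm (z l)) (fun _ => 1)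
    fun l _ => isHomogeneous_linForm (z l)
  have h2 := h1.mul (isHomogeneous_X A j)
  have h3 : ∑ _l ∈ Finset.univ.erase k, 1 + 1 = Fintype.card ι := by
    have := Finset.card_erase_add_one (Finset.mem_univ k)
    simpa using this
  rwa [h3] at h2

theorem map_omitProd {A B : Type*} [CommSemiring A] [CommSemiring B] {n : ℕ} {ι : Type*} [Fintype ι]
    [DecidableEq ι] (g : A →+* B) (z : ι → Fin n → A) (k : ι) (j : Fin n) :
    map g (omitProd z k j) = omitProd (fun l i => g (z l i)) k j := by
  simp [omitProd, map_linForm]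

theorem omitProd_smul {A : Type*} [CommSemiring A] {n : ℕ} {ι : Type*} [Fintype ι]
    [DecidableEq ι] (c : ι → A) (z : ι → Fin n → A) (k : ι) (j : Fin n) :
    omitProd (fun l => c l • z l) k j =
      C (∏ l ∈ Finset.univ.erase k, c l) * omitProd z k j := by
  simp [omitProd, linForm_smul, Finset.prod_mul_distrib, mul_assoc]

theorem sum_C_mul_omitProd {A : Type*} [CommSemiring A] {n : ℕ} {ι : Type*} [Fintype ι]
    [DecidableEq ι] (z : ι → Fin n → A) (k : ι) (v : Fin n → A) :
    ∑ j, C (v j) * omitProd z k j =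
      (∏ l ∈ Finset.univ.erase k, linForm (z l)) * linForm v := by
  simp only [omitProd, linForm, Finset.mul_sum]
  exact Finset.sum_congr rfl fun j _ => by ring

theorem coeff_omitProd_mem {k K : Type*} [Field k] [Field K] [Algebra k K] {n : ℕ} {ι : Type*}
    [Fintype ι] [DecidableEq ι] (F : IntermediateField k K) (z : ι → Fin n → K)
    (hz : ∀ l i, z l i ∈ F) (a : ι) (j : Fin n) (m : Fin n →₀ ℕ) :
    coeff m (omitProd z a j) ∈ F := by
  have := map_omitProd (algebraMap F K) (fun l i => (⟨z l i, hz l i⟩ : F)) a j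
  have h2 : (fun l i => (algebraMap F K) (⟨z l i, hz l i⟩ : F)) = z := rfl
  rw [h2] at this
  rw [← this, coeff_map]
  exact SetLike.coe_mem _

/-- A relation `∑ (∏_{l ≠ a} ℓ_l) ℓ'_a = 0` between products of pairwise non-proportional linear
forms is trivial. -/
theorem eq_smul_of_sum_prod_erase_eq_zero {K : Type*} [Field K] {n : ℕ} {ι : Type*}
    [DecidableEq ι] (z : ι → Fin n → K) (hz : ∀ k, z k ≠ 0) (A : Finset ι)
    (hA : ∀ a ∈ A, ∀ b ∈ A, ∀ c : K, z b = c • z a → a = b) (e : ι → Fin n → K)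
    (hred : ∑ a ∈ A, (∏ l ∈ A.erase a, linForm (z l)) * linForm (e a) = 0) (a : ι) (ha : a ∈ A) :
    ∃ c : K, e a = c • z a := by
  have hdvd : linForm (z a) ∣ (∏ l ∈ A.erase a, linForm (z l)) * linForm (e a) := by
    rw [← Finset.add_sum_erase A _ ha] at hred
    rw [eq_neg_of_add_eq_zero_left hred, dvd_neg]
    refine Finset.dvd_sum fun b hb => ?_
    have hab : a ∈ A.erase b := Finset.mem_erase.2 ⟨(Finset.ne_of_mem_erase hb).symm, ha⟩
    exact (Finset.dvd_prod_of_mem (fun l => linForm (z l)) hab).mul_right _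
  have hp := prime_linForm (hz a)
  rcases hp.dvd_or_dvd hdvd with h | h
  · obtain ⟨b, hb, hab⟩ := (hp.dvd_finsetProd_iff _).1 h
    obtain ⟨c, hc⟩ := eq_smul_of_linForm_dvd hab
    exact absurd (hA a ha b (Finset.mem_of_mem_erase hb) c hc).symm (Finset.ne_of_mem_erase hb)
  · exact eq_smul_of_linForm_dvd h

/-- The linear independence expressing the dimension of the span of the partial products of a
family of linear forms, times arbitrary linear forms. -/
theorem linearIndependent_omitProd {K : Type*} [Field K] {n : ℕ} {ι : Type*} [Fintype ι]
    [DecidableEq ι] (z : ι → Fin n → K) (hz : ∀ k, z k ≠ 0) (A : Finset ι)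
    (hA : ∀ a ∈ A, ∀ b ∈ A, ∀ c : K, z b = c • z a → a = b) (i₀ : ι → Fin n)
    (hi₀ : ∀ k, z k (i₀ k) ≠ 0) (a₀ : ι)
    (κ : Finset (ι × Fin n)) (hκA : ∀ p ∈ κ, p.1 ∈ A)
    (hκ : ∀ p ∈ κ, p.1 ≠ a₀ → p.2 ≠ i₀ p.1) :
    LinearIndependent K (fun p : κ => omitProd z p.1.1 p.1.2) := by
  rw [Fintype.linearIndependent_iff]
  intro g hg
  let e : ι → Fin n → K := fun a j => if h : (a, j) ∈ κ then g ⟨(a, j), h⟩ else 0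
  have he : ∀ p : κ, e p.1.1 p.1.2 = g p := fun p => by simp [e]
  have hsub : κ ⊆ A ×ˢ Finset.univ := fun p hp => by simp [hκA p hp]
  have hsum : ∑ a ∈ A, (∏ l ∈ Finset.univ.erase a, linForm (z l)) * linForm (e a) = 0 := by
    simp only [← sum_C_mul_omitProd]
    rw [← Finset.sum_product', ← Finset.sum_subset hsub]
    · rw [← Finset.sum_coe_sort κ]
      simpa only [smul_eq_C_mul, he] using hg
    · intro p _ hp
      simp [e, hp]
  have hsplit : ∀ a ∈ A, ∏ l ∈ Finset.univ.erase a, linForm (z l) =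
      (∏ l ∈ Aᶜ, linForm (z l)) * ∏ l ∈ A.erase a, linForm (z l) := by
    intro a ha
    rw [← Finset.prod_union]
    · congr 1
      ext l
      simp only [Finset.mem_erase, Finset.mem_univ, Finset.mem_union, Finset.mem_compl]
      have : l = a → l ∈ A := fun h => h ▸ ha
      tauto
    · rw [Finset.disjoint_left]
      intro l hl hl'
      exact Finset.mem_compl.1 hl (Finset.mem_of_mem_erase hl')
  have hne : ∀ l, linForm (z l) ≠ 0 := fun l => linForm_eq_zero_iff.not.2 (hz l)
  have hred : ∑ a ∈ A, (∏ l ∈ A.erase a, linForm (z l)) * linForm (e a) = 0 := by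
    have h1 : (∏ l ∈ Aᶜ, linForm (z l)) *
        ∑ a ∈ A, (∏ l ∈ A.erase a, linForm (z l)) * linForm (e a) = 0 := by
      rw [← hsum, Finset.mul_sum]
      exact Finset.sum_congr rfl fun a ha => by rw [hsplit a ha, mul_assoc]
    exact (mul_eq_zero.1 h1).resolve_left (Finset.prod_ne_zero_iff.2 fun l _ => hne l)
  have hprop := eq_smul_of_sum_prod_erase_eq_zero z hz A hA e hred
  have hzero : ∀ a ∈ A, a ≠ a₀ → e a = 0 := by
    intro a ha hne
    obtain ⟨c, hc⟩ := hprop a ha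
    have h1 : e a (i₀ a) = 0 := by
      simp only [e]
      rw [dif_neg]
      exact fun h => hκ _ h hne rfl
    rw [hc] at h1
    have hc0 : c = 0 := by simpa [hi₀ a] using h1
    rw [hc, hc0, zero_smul]
  have hzero' : ∀ a ∈ A, e a = 0 := by
    intro a ha
    by_cases h : a = a₀
    · rw [Finset.sum_eq_single_of_mem a ha] at hred
      · rw [← linForm_eq_zero_iff]
        exact (mul_eq_zero.1 hred).resolve_left (Finset.prod_ne_zero_iff.2 fun l _ => hne l)
      · intro b hb hba
        rw [hzero b hb (h ▸ hba), linForm_eq_zero_iff.2 rfl, mul_zero]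
    · exact hzero a ha h
  intro p
  rw [← he p, hzero' _ (hκA _ p.2), Pi.zero_apply]

/-- The product of the factorials of the exponents of a monomial. -/
def monoFactorial {n : ℕ} (m : Fin n →₀ ℕ) : ℕ := ∏ i, (m i).factorial

theorem monoFactorial_add_single {n : ℕ} (m : Fin n →₀ ℕ) (j : Fin n) :
    monoFactorial (m + Finsupp.single j 1) = monoFactorial m * (m j + 1) := by
  classical
  unfold monoFactorial
  rw [← Finset.mul_prod_erase _ _ (Finset.mem_univ j),
    ← Finset.mul_prod_erase (Finset.univ) (fun i => (m i).factorial) (Finset.mem_univ j)]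
  have : ∀ i ∈ Finset.univ.erase j, ((m + Finsupp.single j 1 : Fin n →₀ ℕ) i).factorial =
      (m i).factorial := by
    intro i hi
    simp [Finsupp.single_eq_of_ne (Finset.ne_of_mem_erase hi)]
  rw [Finset.prod_congr rfl this]
  simp only [Finsupp.add_apply, Finsupp.single_eq_same, Nat.factorial_succ]
  ring

theorem coeff_iterPderiv {n : ℕ} {K : Type*} [CommSemiring K] (js : List (Fin n))
    (f : MvPolynomial (Fin n) K) (p : Fin n →₀ ℕ) :
    (monoFactorial p : K) * coeff p (iterPderiv js f) =
      monoFactorial (p + (js.map fun j => Finsupp.single j 1).sum) *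
        coeff (p + (js.map fun j => Finsupp.single j 1).sum) f := by
  induction js generalizing p with
  | nil => simp [iterPderiv]
  | cons j js ih =>
    have h := ih (p + Finsupp.single j 1)
    rw [monoFactorial_add_single] at h
    have hc : iterPderiv (j :: js) f = pderiv j (iterPderiv js f) := rfl
    rw [hc, coeff_pderiv, List.map_cons, List.sum_cons, ← add_assoc, ← h]
    push_cast
    ring

/-- The pairing of a polynomial `q` of degree `d` with the form `∑ β_ρ H_ρ`, where `h` lists the
coefficients of the forms `H_ρ`; in characteristic zero it is `q(∂) (∑ β_ρ H_ρ)`. -/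
noncomputable def apolar {A : Type*} [CommSemiring A] {d R n N : ℕ}
    (e : Fin N ≃ Fin R × {m : Fin n →₀ ℕ // (m.sum fun _ k => k) = d})
    (β : Fin R → A) (h : Fin N → A) : MvPolynomial (Fin n) A →ₗ[A] A :=
  ∑ i, (β (e i).1 * monoFactorial (e i).2.1 * h i) • lcoeff A (e i).2.1

theorem apolar_apply {A : Type*} [CommSemiring A] {d R n N : ℕ}
    (e : Fin N ≃ Fin R × {m : Fin n →₀ ℕ // (m.sum fun _ k => k) = d})
    (β : Fin R → A) (h : Fin N → A) (q : MvPolynomial (Fin n) A) :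
    apolar e β h q =
      ∑ i, β (e i).1 * monoFactorial (e i).2.1 * coeff (e i).2.1 q * h i := by
  simp only [apolar, LinearMap.sum_apply, LinearMap.smul_apply, lcoeff_apply, smul_eq_mul]
  exact Finset.sum_congr rfl fun i _ => by ring

theorem map_apolar {A B : Type*} [CommSemiring A] [CommSemiring B] {d R n N : ℕ}
    (e : Fin N ≃ Fin R × {m : Fin n →₀ ℕ // (m.sum fun _ k => k) = d}) (g : A →+* B)
    (β : Fin R → A) (h : Fin N → A) (q : MvPolynomial (Fin n) A) :
    g (apolar e β h q) = apolar e (fun ρ => g (β ρ)) (fun i => g (h i)) (map g q) := by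
  simp [apolar_apply, coeff_map]

theorem apolar_smul_left {A : Type*} [CommSemiring A] {d R n N : ℕ}
    (e : Fin N ≃ Fin R × {m : Fin n →₀ ℕ // (m.sum fun _ k => k) = d}) (c : A)
    (β : Fin R → A) (h : Fin N → A) (q : MvPolynomial (Fin n) A) :
    apolar e (c • β) h q = c * apolar e β h q := by
  simp [apolar_apply, Finset.mul_sum, mul_assoc]

theorem apolar_prod_X {A : Type*} [CommSemiring A] {d R n N : ℕ}
    (e : Fin N ≃ Fin R × {m : Fin n →₀ ℕ // (m.sum fun _ k => k) = d})
    (β : Fin R → A) (H : Fin R → MvPolynomial (Fin n) A) (js : List (Fin n))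
    (hjs : js.length = d) :
    apolar e β (fun i => coeff (e i).2.1 (H (e i).1)) (js.map X).prod =
      eval (0 : Fin n → A) (iterPderiv js (∑ ρ, β ρ • H ρ)) := by
  classical
  set m : Fin n →₀ ℕ := (js.map fun j => Finsupp.single j 1).sum with hm
  have hprod : ((js.map X).prod : MvPolynomial (Fin n) A) = monomial m 1 := by
    rw [hm]
    clear hm m hjs
    induction js with
    | nil => simp
    | cons j js ih => simp [ih, X, monomial_mul]
  have hdeg : (m.sum fun _ k => k) = d := by
    change Finsupp.degree m = d
    rw [← hjs, hm, map_list_sum]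
    simp [List.map_map, Function.comp_def]
  have hr : eval (0 : Fin n → A) (iterPderiv js (∑ ρ, β ρ • H ρ)) =
      ∑ ρ, β ρ * monoFactorial m * coeff m (H ρ) := by
    have h := coeff_iterPderiv js (∑ ρ, β ρ • H ρ) 0
    rw [← hm, zero_add] at h
    have h0 : monoFactorial (0 : Fin n →₀ ℕ) = 1 := by simp [monoFactorial]
    have h1 : eval (0 : Fin n → A) (iterPderiv js (∑ ρ, β ρ • H ρ)) =
        coeff 0 (iterPderiv js (∑ ρ, β ρ • H ρ)) := by
      rw [eval_zero, constantCoeff_eq]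
    rw [h0, Nat.cast_one, one_mul] at h
    rw [h1, h, coeff_sum, Finset.mul_sum]
    refine Finset.sum_congr rfl fun ρ _ => ?_
    rw [coeff_smul, smul_eq_mul]
    ring
  rw [hr, hprod, apolar_apply]
  symm
  refine Finset.sum_of_injOn (fun ρ => e.symm (ρ, ⟨m, hdeg⟩)) ?_ ?_ ?_ ?_
  · intro a _ b _ hab
    simpa using hab
  · simp
  · intro i _ hi
    have : m ≠ (e i).2.1 := by
      intro h
      apply hi
      refine ⟨(e i).1, by simp, ?_⟩
      rw [Equiv.symm_apply_eq]
      exact Prod.ext rfl (Subtype.ext h)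
    simp [coeff_monomial, this]
  · intro ρ _
    simp

theorem mForm_eq_apolar {A : Type*} [CommSemiring A] {d R n N : ℕ} (hd : 1 ≤ d)
    (e : Fin N ≃ Fin R × {m : Fin n →₀ ℕ // (m.sum fun _ k => k) = d})
    (β : Fin R → A) (H : Fin R → MvPolynomial (Fin n) A) (x : Fin (d - 1) → Fin n → A)
    (i : Fin n) :
    mForm d n (∑ ρ, β ρ • H ρ) x i =
      apolar e β (fun i => coeff (e i).2.1 (H (e i).1)) (X i * ∏ k, linForm (x k)) := by
  classical
  have hexp : X i * ∏ k, linForm (x k) =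
      ∑ j : Fin (d - 1) → Fin n, (∏ k, x k (j k)) •
        ((i :: List.ofFn j).map (X : Fin n → MvPolynomial (Fin n) A)).prod := by
    simp only [linForm]
    rw [Finset.prod_univ_sum, Fintype.piFinset_univ, Finset.mul_sum]
    refine Finset.sum_congr rfl fun j _ => ?_
    rw [Finset.prod_mul_distrib, List.map_cons, List.prod_cons, List.map_ofFn, List.prod_ofFn,
      smul_eq_C_mul, map_prod]
    simp only [Function.comp_apply]
    ring
  rw [hexp, map_sum]
  unfold mForm
  refine Finset.sum_congr rfl fun j _ => ?_
  rw [map_smul, apolar_prod_X _ _ _ _ (by simp; omega), smul_eq_mul]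
  rfl

theorem omitProd_eq_prod_update {A : Type*} [CommSemiring A] {n : ℕ} {ι : Type*} [Fintype ι]
    [DecidableEq ι] (z : ι → Fin n → A) (k : ι) (j : Fin n) :
    omitProd z k j = ∏ l, linForm (Function.update z k (Pi.single j 1) l) := by
  rw [omitProd, ← Finset.prod_erase_mul _ _ (Finset.mem_univ k), Function.update_self,
    linForm_single]
  congr 1
  exact Finset.prod_congr rfl fun l hl => by rw [Function.update_of_ne (Finset.ne_of_mem_erase hl)]

/-- A matrix of small rank has a nonzero left null vector with prescribed zeros. -/
theorem Matrix.exists_vecMul_eq_zero_of_rank_add_le {K M : Type*} [Field K] [Fintype M] {n R : ℕ}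
    (J : Matrix (Fin n) M K) (hR : 1 ≤ R) (hJ : J.rank + R ≤ n) :
    ∃ w : Fin n → K, w ≠ 0 ∧ (∀ i, i.val + 1 < R → w i = 0) ∧ Matrix.vecMul w J = 0 := by
  classical
  let V : (Fin n → K) →ₗ[K] (M → K) := J.vecMulLinear
  let U : (Fin n → K) →ₗ[K] (Fin (R - 1) → K) := LinearMap.funLeft K K (Fin.castLE (by omega))
  have hV := LinearMap.finrank_range_add_finrank_ker V
  have hU := LinearMap.finrank_range_add_finrank_ker U
  have hrank : Module.finrank K (LinearMap.range V) = J.rank := by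
    rw [← J.rank_transpose, Matrix.rank, Matrix.mulVecLin_transpose]
  have hUr : Module.finrank K (LinearMap.range U) ≤ R - 1 := by
    simpa using Submodule.finrank_le (LinearMap.range U)
  have hsup := Submodule.finrank_le (LinearMap.ker V ⊔ LinearMap.ker U)
  have hadd := Submodule.finrank_sup_add_finrank_inf_eq (LinearMap.ker V) (LinearMap.ker U)
  rw [Module.finrank_fintype_fun_eq_card, Fintype.card_fin] at hV hU hsup
  have hpos : 0 < Module.finrank K ↥(LinearMap.ker V ⊓ LinearMap.ker U) := by omega
  obtain ⟨⟨w, hwV, hwU⟩, hw⟩ := @exists_ne _ (Module.finrank_pos_iff.1 hpos) 0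
  refine ⟨w, fun h => hw (Subtype.ext h), fun i hi => ?_, hwV⟩
  exact congrFun (LinearMap.mem_ker.1 hwU) ⟨i, by omega⟩

/-- Systems with large `σ*` admit a solution of an explicit system of polynomial equations. -/
theorem exists_degenerate_of_le_sigmaStar {d R n N : ℕ} (hd : 1 ≤ d) (hR : 1 ≤ R)
    (e : Fin N ≃ Fin R × {m : Fin n →₀ ℕ // (m.sum fun _ k => k) = d})
    (H : Fin R → MvPolynomial (Fin n) ℂ) (hH : R ≤ sigmaStar d n R H) :
    ∃ (β : Fin R → ℂ) (z : Option (Fin (d - 1)) → Fin n → ℂ), β ≠ 0 ∧ (∀ k, z k ≠ 0) ∧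
      (∀ i, i.val + 1 < R → z none i = 0) ∧
      ∀ k j, apolar e β (fun i => coeff (e i).2.1 (H (e i).1)) (omitProd z k j) = 0 := by
  classical
  unfold sigmaStar at hH
  set s := {s : ℕ | ∃ β : Fin R → ℂ, β ≠ 0 ∧ ∃ x : Fin (d - 1) → Fin n → ℂ,
    (∀ k, x k ≠ 0) ∧ mForm d n (∑ ρ, β ρ • H ρ) x = 0 ∧
    s = n - (jacMat d n (∑ ρ, β ρ • H ρ) x).rank} with hs
  have hne : s.Nonempty := by
    by_contra h
    rw [Set.not_nonempty_iff_eq_empty] at h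
    rw [h] at hH
    simp at hH
    omega
  have hbdd : BddAbove s := ⟨n, by rintro _ ⟨_, _, _, _, _, rfl⟩; omega⟩
  obtain ⟨β, hβ, x, hx, hm, hsr⟩ := Nat.sSup_mem hne hbdd
  obtain ⟨w, hw, hw0, hwJ⟩ := Matrix.exists_vecMul_eq_zero_of_rank_add_le
    (jacMat d n (∑ ρ, β ρ • H ρ) x) hR (by omega)
  refine ⟨β, fun k => k.elim w x, hβ, ?_, hw0, ?_⟩
  · rintro (_ | k)
    exacts [hw, hx k]
  rintro (_ | k) j
  · rw [omitProd_eq_prod_update, Fintype.prod_option, Function.update_self, linForm_single]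
    have h := congrFun hm j
    rw [mForm_eq_apolar hd e] at h
    simpa using h
  · have h := congrFun hwJ (k, j)
    rw [omitProd_eq_prod_update, Fintype.prod_option]
    have h2 : ∀ l, Function.update (fun k : Option (Fin (d - 1)) => k.elim w x) (some k)
        (Pi.single j 1) (some l) = Function.update x k (Pi.single j 1) l := by
      intro l
      by_cases hl : l = k
      · subst hl; simp
      · simp [hl]
    simp only [h2]
    rw [Function.update_of_ne (by simp)]
    have h3 : ∀ q : MvPolynomial (Fin n) ℂ, linForm w * q = ∑ i, w i • (X i * q) := fun q => by
      simp [linForm, Finset.sum_mul, smul_eq_C_mul, mul_assoc]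
    change apolar e β _ (linForm w * _) = 0
    rw [h3, map_sum]
    simp only [map_smul, smul_eq_mul]
    simpa only [Pi.zero_apply, Matrix.vecMul, dotProduct, jacMat, mForm_eq_apolar hd e] using h

/-- The normalized form of the dimension count: over a field, a generic system of forms has no
normalized degenerate data. -/
theorem not_degenerate_of_normalized {K : Type*} [Field K] [Algebra ℚ K] {d R n N : ℕ}
    (hR : 1 ≤ R) (hRn : R ≤ n)
    (e : Fin N ≃ Fin R × {m : Fin n →₀ ℕ // (m.sum fun _ k => k) = d})
    {h : Fin N → K} (hh : AlgebraicIndependent ℚ h) (β : Fin R → K) (ρ₀ : Fin R) (hβ : β ρ₀ = 1)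
    {ι : Type*} [Fintype ι] [DecidableEq ι] (hι : Fintype.card ι = d) (z : ι → Fin n → K)
    (i₀ : ι → Fin n) (hi₀ : ∀ k, z k (i₀ k) = 1) (hz : ∀ a b, ∀ c : K, z b = c • z a → z a = z b)
    (k₀ : ι) (hk₀ : ∀ i, i.val + 1 < R → z k₀ i = 0) :
    ∃ k j, apolar e β h (omitProd z k j) ≠ 0 := by
  classical
  by_contra! hrel
  have : CharZero K := algebraRat.charZero K
  obtain ⟨A', -, hA'⟩ := Set.exists_subset_bijOn (Set.univ : Set ι) z
  let A : Finset ι := A'.toFinset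
  have hinj : ∀ a ∈ A, ∀ b ∈ A, z a = z b → a = b := fun a ha b hb hab =>
    hA'.injOn (by simpa [A] using ha) (by simpa [A] using hb) hab
  have hrep : ∀ l, ∃ a ∈ A, z a = z l := fun l => by
    obtain ⟨a, ha, hal⟩ := hA'.surjOn ⟨l, Set.mem_univ l, rfl⟩
    exact ⟨a, by simpa [A] using ha, hal⟩
  obtain ⟨a₀, ha₀, hak⟩ := hrep k₀
  have hz0 : ∀ i, i.val + 1 < R → z a₀ i = 0 := fun i hi => by rw [hak]; exact hk₀ i hi
  let F₀ : Finset (ι × Fin n) := (A ×ˢ Finset.univ).filter fun p => p.2 ≠ i₀ p.1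
  let zero : ι × Fin n → Prop := fun p => p.1 = a₀ ∧ p.2.val + 1 < R
  let S : Finset K := (F₀.filter fun p => ¬ zero p).image (fun p => z p.1 p.2) ∪
    (Finset.univ.erase ρ₀).image β
  let κ : Finset (ι × Fin n) := insert (a₀, i₀ a₀) F₀
  have hzero : R - 1 ≤ (F₀.filter zero).card := by
    have : (Finset.univ : Finset (Fin (R - 1))).card ≤ (F₀.filter zero).card := by
      refine Finset.card_le_card_of_injOn (fun i => (a₀, Fin.castLE (by omega) i)) ?_ ?_
      · intro i _
        have hlt : (Fin.castLE (show R - 1 ≤ n by omega) i).val + 1 < R := by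
          have := i.2
          simp only [Fin.val_castLE]
          omega
        have hne : Fin.castLE (show R - 1 ≤ n by omega) i ≠ i₀ a₀ := by
          intro hc
          have h0 := hz0 _ hlt
          rw [hc, hi₀] at h0
          exact one_ne_zero h0
        simp only [Finset.coe_filter, Set.mem_ofPred_eq]
        exact ⟨by simp [F₀, ha₀, hne], rfl, hlt⟩
      · intro i _ j _ hij
        simpa using hij
    simpa using this
  have hS : S.card ≤ F₀.card := by
    have h1 : S.card ≤ (F₀.filter fun p => ¬ zero p).card + (R - 1) := by
      refine (Finset.card_union_le _ _).trans (add_le_add Finset.card_image_le ?_)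
      refine Finset.card_image_le.trans ?_
      simp [Finset.card_erase_of_mem]
    have h2 := Finset.card_filter_add_card_filter_not (s := F₀) zero
    omega
  have hκ : κ.card = F₀.card + 1 := Finset.card_insert_of_notMem (by simp [F₀])
  have hzS : ∀ l i, z l i ∈ IntermediateField.adjoin ℚ (S : Set K) := by
    intro l i
    obtain ⟨a, ha, hal⟩ := hrep l
    rw [← hal]
    by_cases hi : i = i₀ a
    · rw [hi, hi₀]; exact one_mem _
    by_cases hza : zero (a, i)
    · obtain ⟨h1, h2⟩ := hza
      simp only at h1 h2
      rw [h1, hz0 i h2]; exact zero_mem _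
    · refine IntermediateField.subset_adjoin _ _ ?_
      refine Finset.mem_coe.2 (Finset.mem_union_left _ (Finset.mem_image.2 ⟨(a, i), ?_, rfl⟩))
      simp [F₀, ha, hi, hza]
  have hβS : ∀ ρ, β ρ ∈ IntermediateField.adjoin ℚ (S : Set K) := by
    intro ρ
    by_cases hρ : ρ = ρ₀
    · rw [hρ, hβ]; exact one_mem _
    · refine IntermediateField.subset_adjoin _ _ ?_
      exact Finset.mem_coe.2 (Finset.mem_union_right _ (Finset.mem_image.2 ⟨ρ, by simp [hρ], rfl⟩))
  let τ : κ → Fin N → K := fun p i =>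
    β (e i).1 * monoFactorial (e i).2.1 * coeff (e i).2.1 (omitProd z p.1.1 p.1.2)
  have hind : LinearIndependent K (fun p : κ => omitProd z p.1.1 p.1.2) := by
    refine linearIndependent_omitProd z (fun k hk => ?_) A
      (fun a ha b hb c hc => hinj a ha b hb (hz a b c hc)) i₀
      (fun k => by rw [hi₀]; exact one_ne_zero) a₀ κ ?_ ?_
    · have := hi₀ k
      rw [hk] at this
      exact zero_ne_one this
    · intro p hp
      rcases Finset.mem_insert.1 hp with rfl | hp
      · exact ha₀
      · simp only [F₀, Finset.mem_filter, Finset.mem_product] at hp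
        exact hp.1.1
    · intro p hp hpa
      rcases Finset.mem_insert.1 hp with rfl | hp
      · exact absurd rfl hpa
      · simp only [F₀, Finset.mem_filter] at hp
        exact hp.2
  have hτ : LinearIndependent K τ := by
    rw [Fintype.linearIndependent_iff] at hind ⊢
    intro g hg
    refine hind g ?_
    ext m
    rw [coeff_zero]
    by_cases hm : (m.sum fun _ k => k) = d
    · have h1 := congrFun hg (e.symm (ρ₀, ⟨m, hm⟩))
      simp only [τ, Finset.sum_apply, Pi.smul_apply, Equiv.apply_symm_apply, hβ, smul_eq_mul,
        one_mul, Pi.zero_apply] at h1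
      have h2 : (monoFactorial m : K) ≠ 0 := by
        rw [Nat.cast_ne_zero, monoFactorial]
        exact Finset.prod_ne_zero_iff.2 fun i _ => Nat.factorial_ne_zero _
      refine (mul_eq_zero.1 ?_).resolve_left h2
      rw [← h1, coeff_sum, Finset.mul_sum]
      refine Finset.sum_congr rfl fun p _ => ?_
      rw [coeff_smul, smul_eq_mul]
      ring
    · rw [coeff_sum]
      refine Finset.sum_eq_zero fun p _ => ?_
      rw [coeff_smul, (isHomogeneous_omitProd z p.1.1 p.1.2).coeff_eq_zero, smul_zero]
      rw [hι]
      exact hm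
  have hle := hh.card_relations_le S τ (fun p i => mul_mem (mul_mem (hβS _) (natCast_mem _ _))
    (coeff_omitProd_mem _ z hzS _ _ _)) hτ (fun p => by rw [← apolar_apply]; exact hrel _ _)
  rw [Fintype.card_coe] at hle
  omega

/-- Over a field, a system of forms with algebraically independent coefficients has no degenerate
data. -/
theorem not_degenerate_of_algebraicIndependent {K : Type*} [Field K] [Algebra ℚ K] {d R n N : ℕ}
    (hR : 1 ≤ R) (hRn : R ≤ n)
    (e : Fin N ≃ Fin R × {m : Fin n →₀ ℕ // (m.sum fun _ k => k) = d})
    {h : Fin N → K} (hh : AlgebraicIndependent ℚ h) (β : Fin R → K) (hβ : β ≠ 0)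
    {ι : Type*} [Fintype ι] [DecidableEq ι] (hι : Fintype.card ι = d) (z : ι → Fin n → K)
    (hz : ∀ k, z k ≠ 0) (k₀ : ι) (hk₀ : ∀ i, i.val + 1 < R → z k₀ i = 0) :
    ∃ k j, apolar e β h (omitProd z k j) ≠ 0 := by
  classical
  by_contra! hrel
  obtain ⟨ρ₀, hρ₀⟩ := Function.ne_iff.1 hβ
  have : Nonempty (Fin n) := ⟨⟨0, by omega⟩⟩
  let lead : (Fin n → K) → Fin n := fun v => Classical.epsilon fun i => v i ≠ 0
  have hlead : ∀ v : Fin n → K, v ≠ 0 → v (lead v) ≠ 0 := fun v hv =>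
    Classical.epsilon_spec (Function.ne_iff.1 hv)
  have hlead_smul : ∀ (c : K) (v : Fin n → K), c ≠ 0 → lead (c • v) = lead v := by
    intro c v hc
    simp only [lead]
    congr 1
    funext i
    simp [hc]
  let c : ι → K := fun k => (z k (lead (z k)))⁻¹
  have hc : ∀ k, c k ≠ 0 := fun k => inv_ne_zero (hlead _ (hz k))
  let z' : ι → Fin n → K := fun k => c k • z k
  have hz'1 : ∀ k, z' k (lead (z' k)) = 1 := fun k => by
    simp only [z']
    rw [hlead_smul _ _ (hc k)]
    exact inv_mul_cancel₀ (hlead _ (hz k))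
  obtain ⟨k, j, hkj⟩ := not_degenerate_of_normalized hR hRn e hh ((β ρ₀)⁻¹ • β) ρ₀
    (inv_mul_cancel₀ hρ₀) hι z' (fun k => lead (z' k)) hz'1
    (by
      intro a b t hab
      have ht : t ≠ 0 := by
        rintro rfl
        have := hz'1 b
        rw [hab] at this
        simp at this
      have h1 := hz'1 b
      rw [hab, hlead_smul t _ ht, Pi.smul_apply, hz'1, smul_eq_mul, mul_one] at h1
      rw [hab, h1, one_smul])
    k₀ (fun i hi => by simp [z', hk₀ i hi])
  apply hkj
  rw [apolar_smul_left, omitProd_smul, ← smul_eq_C_mul, map_smul, hrel, smul_zero, mul_zero]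

/-- A `ℚ`-algebra carries no unimodular degenerate data for a
system of forms with algebraically independent coefficients. -/
theorem not_degenerate_of_unimodular {P : Type*} [CommRing P] [Algebra ℚ P] {d R n N : ℕ}
    (hR : 1 ≤ R) (hRn : R ≤ n)
    (e : Fin N ≃ Fin R × {m : Fin n →₀ ℕ // (m.sum fun _ k => k) = d})
    {h : Fin N → P} (hh : AlgebraicIndependent ℚ h) (β β' : Fin R → P)
    (hβ : ∑ ρ, β ρ * β' ρ = 1)
    {ι : Type*} [Fintype ι] [DecidableEq ι] (hι : Fintype.card ι = d) (z z' : ι → Fin n → P)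
    (hz : ∀ k, ∑ i, z k i * z' k i = 1) (k₀ : ι) (hk₀ : ∀ i, i.val + 1 < R → z k₀ i = 0) :
    ∃ k j, apolar e β h (omitProd z k j) ≠ 0 := by
  obtain ⟨K, _, _, g, hg⟩ := exists_algHom_field_algebraicIndependent h hh
  by_contra! hrel
  obtain ⟨k, j, hkj⟩ := not_degenerate_of_algebraicIndependent hR hRn e hg (fun ρ => g (β ρ))
    (by
      intro h0
      have := congrArg g hβ
      rw [map_sum, map_one] at this
      simp only [map_mul, congrFun h0, Pi.zero_apply, zero_mul, Finset.sum_const_zero] at this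
      exact zero_ne_one this)
    hι (fun k i => g (z k i))
    (by
      intro k h0
      have := congrArg g (hz k)
      rw [map_sum, map_one] at this
      have h1 : ∀ i, g (z k i) = 0 := congrFun h0
      simp only [map_mul, h1, zero_mul, Finset.sum_const_zero] at this
      exact zero_ne_one this)
    k₀ (fun i hi => by simp [hk₀ i hi])
  apply hkj
  have := map_apolar e (g : P →+* K) β h (omitProd z k j)
  rw [hrel, map_zero, map_omitProd] at this
  exact this.symm

theorem exists_sum_mul_eq_one {K ι : Type*} [Field K] [Fintype ι] {v : ι → K} (hv : v ≠ 0) :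
    ∃ v' : ι → K, ∑ i, v i * v' i = 1 := by
  classical
  obtain ⟨i, hi⟩ := Function.ne_iff.1 hv
  refine ⟨Pi.single i (v i)⁻¹, ?_⟩
  rw [Finset.sum_eq_single i]
  · simpa using mul_inv_cancel₀ hi
  · intro j _ hj
    simp [hj]
  · simp

/-- Systems of rational forms with large `σ*` satisfy a common nontrivial equation. -/
theorem exists_ne_zero_eval_eq_zero_of_le_sigmaStarQ {d R n N : ℕ} (hd : 1 ≤ d) (hR : 1 ≤ R)
    (hRn : R ≤ n) (e : Fin N ≃ Fin R × {m : Fin n →₀ ℕ // (m.sum fun _ k => k) = d}) :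
    ∃ Φ : MvPolynomial (Fin N) ℚ, Φ ≠ 0 ∧
      ∀ H : Fin R → MvPolynomial (Fin n) ℚ, R ≤ sigmaStarQ d n R H →
        eval (fun i => (H (e i).1).coeff (e i).2.1) Φ = 0 := by
  classical
  by_contra! hbad
  have hbad' : ∀ Φ : {Φ : MvPolynomial (Fin N) ℚ // Φ ≠ 0},
      ∃ (a : Fin N → ℚ) (β β' : Fin R → ℂ) (z z' : Option (Fin (d - 1)) → Fin n → ℂ),
        eval a Φ.1 ≠ 0 ∧ ∑ ρ, β ρ * β' ρ = 1 ∧ (∀ k, ∑ i, z k i * z' k i = 1) ∧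
        (∀ i, i.val + 1 < R → z none i = 0) ∧
        ∀ k j, apolar e β (fun i => algebraMap ℚ ℂ (a i)) (omitProd z k j) = 0 := by
    rintro ⟨Φ, hΦ⟩
    obtain ⟨H, hH, hev⟩ := hbad Φ hΦ
    obtain ⟨β, z, hβ, hz, hz0, hrel⟩ := exists_degenerate_of_le_sigmaStar hd hR e _ hH
    obtain ⟨β', hβ'⟩ := exists_sum_mul_eq_one hβ
    choose z' hz' using fun k => exists_sum_mul_eq_one (hz k)
    refine ⟨_, β, β', z, z', hev, hβ', hz', hz0, fun k j => ?_⟩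
    simpa only [coeff_map] using hrel k j
  choose a β β' z z' ha hβ hz hz0 hrel using hbad'
  let P := {Φ : MvPolynomial (Fin N) ℚ // Φ ≠ 0} → ℂ
  let h : Fin N → P := fun i Φ => algebraMap ℚ ℂ (a Φ i)
  have hh : AlgebraicIndependent ℚ h := by
    rw [algebraicIndependent_iff]
    intro Φ hΦ
    by_contra hne
    have h1 := congrFun hΦ ⟨Φ, hne⟩
    have h2 : (aeval h Φ) ⟨Φ, hne⟩ = aeval (fun i => h i ⟨Φ, hne⟩) Φ := by
      have := comp_aeval_apply (Pi.evalAlgHom ℚ (fun _ => ℂ) ⟨Φ, hne⟩) Φ (f := h)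
      exact this
    rw [h2] at h1
    simp only [h] at h1
    rw [← Function.comp_def (algebraMap ℚ ℂ), aeval_algebraMap_apply, Pi.zero_apply,
      map_eq_zero] at h1
    apply ha ⟨Φ, hne⟩
    simpa [aeval_eq_eval] using h1
  obtain ⟨k, j, hkj⟩ := not_degenerate_of_unimodular hR hRn e hh (fun ρ Φ => β Φ ρ)
    (fun ρ Φ => β' Φ ρ) (funext fun Φ => (Finset.sum_apply Φ _ _).trans (hβ Φ))
    (ι := Option (Fin (d - 1))) (by simp; omega) (fun k i Φ => z Φ k i) (fun k i Φ => z' Φ k i)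
    (fun k => funext fun Φ => (Finset.sum_apply Φ _ _).trans (hz Φ k)) none
    (fun i hi => funext fun Φ => hz0 Φ i hi)
  apply hkj
  funext Φ
  have := map_apolar e (Pi.evalRingHom (fun _ => ℂ) Φ : P →+* ℂ) (fun ρ Φ => β Φ ρ) h
    (omitProd (fun k i Φ => z Φ k i) k j)
  rw [map_omitProd] at this
  exact this.trans (hrel Φ k j)

/-- A list of coefficients, all nonzero, comes from a system of forms of exact degree `d`. -/
theorem exists_isHomogeneous_coeff_eq {K : Type*} [Field K] {d R n N : ℕ} (hn : 1 ≤ n)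
    (e : Fin N ≃ Fin R × {m : Fin n →₀ ℕ // (m.sum fun _ k => k) = d}) (a : Fin N → K)
    (ha : ∀ i, a i ≠ 0) :
    ∃ H : Fin R → MvPolynomial (Fin n) K, (∀ ρ, (H ρ).IsHomogeneous d) ∧
      (∀ ρ, (H ρ).totalDegree = d) ∧ (fun i => (H (e i).1).coeff (e i).2.1) = a := by
  classical
  let H : Fin R → MvPolynomial (Fin n) K := fun ρ =>
    ∑ i, if (e i).1 = ρ then monomial (e i).2.1 (a i) else 0
  have hH : ∀ ρ, (H ρ).IsHomogeneous d := fun ρ => IsHomogeneous.sum _ _ _ fun i _ => by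
    split_ifs
    · exact isHomogeneous_monomial _ (e i).2.2
    · exact isHomogeneous_zero _ _ _
  have hc : ∀ i, coeff (e i).2.1 (H (e i).1) = a i := by
    intro i
    simp only [H, coeff_sum]
    rw [Finset.sum_eq_single i]
    · simp
    · intro j _ hj
      split_ifs with h1
      · rw [coeff_monomial, if_neg]
        intro h2
        exact hj (e.injective (Prod.ext h1 (Subtype.ext h2)))
      · simp
    · simp
  refine ⟨H, hH, fun ρ => (hH ρ).totalDegree fun h0 => ?_, funext hc⟩
  let i := e.symm (ρ, ⟨Finsupp.single ⟨0, hn⟩ d, by simp⟩)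
  have h1 : (e i).1 = ρ := by simp [i]
  apply ha i
  rw [← hc i, h1, h0, coeff_zero]

/-- The condition `σ*(H) ≤ R - 1` defines a nonempty Zariski
open subset of the space of systems of `R` forms of degree `d` in `n ≥ R`
variables: there is a nonzero polynomial `Φ` in the `N = R·binom(n+d-1,d)`
coefficients vanishing on every system with `σ*(H) ≥ R`. -/
theorem statement3 (d R n : ℕ) (hd : 2 ≤ d) (hR : 1 ≤ R) (hn : R ≤ n)
    (N : ℕ) (hN : N = R * (n + d - 1).choose d)
    (e : Fin N ≃ Fin R × {m : Fin n →₀ ℕ // (m.sum fun _ k => k) = d}) :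
    (∃ Φ : MvPolynomial (Fin N) ℚ, Φ ≠ 0 ∧
      ∀ H : Fin R → MvPolynomial (Fin n) ℚ, (∀ ρ, (H ρ).IsHomogeneous d) →
        R ≤ sigmaStarQ d n R H →
        MvPolynomial.eval (fun i => (H (e i).1).coeff (e i).2.1) Φ = 0) ∧
    ∃ H : Fin R → MvPolynomial (Fin n) ℚ,
      (∀ ρ, (H ρ).IsHomogeneous d) ∧ (∀ ρ, (H ρ).totalDegree = d) ∧
      sigmaStarQ d n R H ≤ R - 1 := by
  obtain ⟨Φ, hΦ, hvan⟩ := exists_ne_zero_eval_eq_zero_of_le_sigmaStarQ (by omega) hR hn e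
  refine ⟨⟨Φ, hΦ, fun H _ => hvan H⟩, ?_⟩
  have hne : Φ * ∏ i, X i ≠ 0 := mul_ne_zero hΦ (Finset.prod_ne_zero_iff.2 fun i _ => X_ne_zero i)
  obtain ⟨a, ha⟩ : ∃ a, eval a (Φ * ∏ i, X i) ≠ 0 := by
    by_contra! h
    exact hne (MvPolynomial.funext fun a => by rw [h a, map_zero])
  rw [map_mul, map_prod] at ha
  simp only [eval_X] at ha
  obtain ⟨H, hH, hHd, hHa⟩ := exists_isHomogeneous_coeff_eq (hR.trans hn) e a
    fun i => Finset.prod_ne_zero_iff.1 (right_ne_zero_of_mul ha) i (Finset.mem_univ i)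
  refine ⟨H, hH, hHd, ?_⟩
  by_contra hlt
  refine left_ne_zero_of_mul ha ?_
  rw [← hHa]
  exact hvan H (by omega)
end
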